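/- arXiv:2511.13128 — 11 statements merged into one kernel-verified Lean document; each statement's English description precedes it below -/
import Mathlib

section
/- If G is a finite simple graph that is (P2 ∪ P4, diamond)-free with ω(G) = 2, then χ(G) ≤ 4. -/
open SimpleGraph

/-- The disjoint union `P2 ∪ P4`: vertices `0,1` form a `P2` and `2,3,4,5` form a `P4`. -/
def P2UP4 : SimpleGraph (Fin 6) :=
  SimpleGraph.fromRel (fun i j =>
    ((i : ℕ) = 0 ∧ (j : ℕ) = 1) ∨ ((i : ℕ) = 2 ∧ (j : ℕ) = 3) ∨
    ((i : ℕ) = 3 ∧ (j : ℕ) = 4) ∨ ((i : ℕ) = 4 ∧ (j : ℕ) = 5))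

/-- The diamond: `K4` minus the edge `{0,1}`. -/
def diamond : SimpleGraph (Fin 4) :=
  SimpleGraph.fromRel (fun i j =>
    ¬(((i : ℕ) = 0 ∧ (j : ℕ) = 1) ∨ ((i : ℕ) = 1 ∧ (j : ℕ) = 0)))

/-- `G` contains no induced subgraph isomorphic to `H`. -/
def IsIndFree {α β : Type*} (H : SimpleGraph α) (G : SimpleGraph β) : Prop :=
  IsEmpty (H ↪g G)

/-- A triangle-free graph without induced `P4` (so that the ends of every three-edge path on four
vertices are adjacent) is bipartite. -/
theorem colorable_two_of_triangle_free_of_P4_free {W : Type*} (H : SimpleGraph W)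
    (ht : ∀ a b c, H.Adj a b → H.Adj b c → ¬ H.Adj a c)
    (hp : ∀ a b c d, a ≠ c → b ≠ d → H.Adj a b → H.Adj b c → H.Adj c d → H.Adj a d) :
    H.Colorable 2 := by
  classical
  have near : ∀ r v, H.Reachable r v → v = r ∨ H.Adj r v ∨ ∃ w, H.Adj r w ∧ H.Adj w v := by
    intro r v h
    rw [SimpleGraph.reachable_iff_reflTransGen] at h
    induction h with
    | refl => exact Or.inl rfl
    | @tail b c _ hbc ih =>
      rcases ih with rfl | h | ⟨w, hw, hb⟩
      · exact Or.inr (Or.inl hbc)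
      · exact Or.inr (Or.inr ⟨b, h, hbc⟩)
      · by_cases hwc : w = c
        · exact Or.inr (Or.inl (hwc ▸ hw))
        · by_cases hrb : r = b
          · exact Or.inr (Or.inl (hrb ▸ hbc))
          · exact Or.inr (Or.inl (hp r w b c hrb hwc hw hb hbc))
  let rep : W → W := fun v => (H.connectedComponentMk v).out
  have hrep : ∀ v, H.Reachable (rep v) v := fun v =>
    SimpleGraph.ConnectedComponent.exact (Quot.out_eq (H.connectedComponentMk v))
  have hrep_adj : ∀ u v, H.Adj u v → rep u = rep v := fun u v h => by
    simp only [rep, SimpleGraph.ConnectedComponent.sound h.reachable]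
  let C : H.Coloring Bool := SimpleGraph.Coloring.mk (fun v => decide (H.Adj (rep v) v)) (by
    intro u v huv heq
    have hr := hrep_adj u v huv
    have hu := hrep u
    simp only [decide_eq_decide, ← hr] at heq
    by_cases h : H.Adj (rep u) u
    · exact ht _ _ _ h huv (heq.1 h)
    · have h' : ¬ H.Adj (rep u) v := fun k => h (heq.2 k)
      rcases near _ _ hu with k | k | ⟨w, hw, hwu⟩
      · exact h' (k ▸ huv)
      · exact h k
      · refine h' (hp _ w u v ?_ ?_ hw hwu huv)
        · intro k
          exact h' (k.symm ▸ huv)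
        · rintro rfl
          exact h' hw)
  simpa using C.colorable

/-- In a triangle-free graph without induced `P2 ∪ P4`, the ends of a three-edge path on four
vertices avoiding the closed neighbourhoods of both ends of an edge are adjacent. -/
theorem adj_of_path_of_P2UP4_free {V : Type*} {G : SimpleGraph V} (h : IsIndFree P2UP4 G)
    (ht : ∀ a b c, G.Adj a b → G.Adj b c → ¬ G.Adj a c) {x y a b c d : V} (hxy : G.Adj x y)
    (hA : ∀ v ∈ [a, b, c, d], ¬ G.Adj x v ∧ ¬ G.Adj y v)
    (hac : a ≠ c) (hbd : b ≠ d) (hab : G.Adj a b) (hbc : G.Adj b c) (hcd : G.Adj c d) :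
    G.Adj a d := by
  by_contra had
  simp only [List.mem_cons, List.not_mem_nil, or_false, forall_eq_or_imp, forall_eq] at hA
  obtain ⟨⟨xa, ya⟩, ⟨xb, yb⟩, ⟨xc, yc⟩, xd, yd⟩ := hA
  have nac := ht _ _ _ hab hbc
  have nbd := ht _ _ _ hbc hcd
  have key : ∀ i j, G.Adj (![x, y, a, b, c, d] i) (![x, y, a, b, c, d] j) ↔ P2UP4.Adj i j := by
    intro i j
    fin_cases i <;> fin_cases j <;>
      simp [P2UP4, *, hxy.symm, hab.symm, hbc.symm, hcd.symm, G.adj_comm _ x, G.adj_comm _ y,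
        G.adj_comm c a, G.adj_comm d a, G.adj_comm d b]
  have inj : Function.Injective ![x, y, a, b, c, d] := by
    intro i j hij
    fin_cases i <;> fin_cases j <;> first | rfl | (exfalso; simp at hij; subst hij; simp_all [G.adj_comm])
  exact h.false ⟨⟨_, inj⟩, key _ _⟩

theorem chi_le_four_of_omega_eq_two {V : Type*} [Fintype V] (G : SimpleGraph V)
    (h1 : IsIndFree P2UP4 G) (h2 : IsIndFree diamond G)
    (hw : G.cliqueNum = 2) : G.chromaticNumber ≤ 4 := by
  classical
  have ht : ∀ a b c, G.Adj a b → G.Adj b c → ¬ G.Adj a c := by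
    intro a b c hab hbc hac
    have hs : G.IsNClique 3 {a, b, c} := SimpleGraph.is3Clique_triple_iff.2 ⟨hab, hac, hbc⟩
    have := hs.isClique.card_le_cliqueNum
    rw [hs.card_eq, hw] at this
    omega
  obtain ⟨s, hs⟩ := G.exists_isNClique_cliqueNum
  obtain ⟨x, y, hne, rfl⟩ := Finset.card_eq_two.1 (hs.card_eq.trans hw)
  have hxy : G.Adj x y := hs.isClique (by simp) (by simp) hne
  let A : Set V := {v | ¬ G.Adj x v ∧ ¬ G.Adj y v}
  obtain ⟨C⟩ : (G.induce A).Colorable 2 :=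
    colorable_two_of_triangle_free_of_P4_free _ (fun a b c => ht a b c) (by
      intro a b c d hac hbd hab hbc hcd
      refine adj_of_path_of_P2UP4_free h1 ht hxy ?_ (Subtype.coe_injective.ne hac)
        (Subtype.coe_injective.ne hbd) hab hbc hcd
      simp only [List.mem_cons, List.not_mem_nil, or_false, forall_eq_or_imp, forall_eq]
      exact ⟨a.2, b.2, c.2, d.2⟩)
  let D : G.Coloring (Bool ⊕ Fin 2) := SimpleGraph.Coloring.mk
    (fun v => if h : v ∈ A then Sum.inr (C ⟨v, h⟩) else Sum.inl (decide (G.Adj x v))) (by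
      intro u v huv heq
      by_cases hu : u ∈ A <;> by_cases hv : v ∈ A <;>
        simp only [hu, hv, dite_true, dite_false, reduceCtorEq, Sum.inr.injEq, Sum.inl.injEq,
          decide_eq_decide] at heq
      · exact C.valid (show (G.induce A).Adj ⟨u, hu⟩ ⟨v, hv⟩ from huv) heq
      · by_cases hxu : G.Adj x u
        · exact ht _ _ _ hxu huv (heq.1 hxu)
        · have hxv : ¬ G.Adj x v := fun k => hxu (heq.2 k)
          have hyu : G.Adj y u := by by_contra k; exact hu ⟨hxu, k⟩
          have hyv : G.Adj y v := by by_contra k; exact hv ⟨hxv, k⟩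
          exact ht _ _ _ hyu huv hyv)
  have hD := D.colorable.chromaticNumber_le
  simpa using hD
end

section
/- Let G be a finite simple graph containing two disjoint cliques X and Y such that min{|X|, |Y|} ≥ 2 and max{|X|, |Y|} ≥ 3. If the set of edges between X and Y forms a nonempty matching (no two such edges share a vertex, and there is at least one such edge), then for any x ∈ X and y ∈ Y, the subgraph of G induced on X ∪ Y contains an induced path on 4 vertices whose vertex set includes both x and y. -/
open SimpleGraph

/-- Two disjoint edges `ab` and `cd` joined by the single edge `bc` form an induced `P4`. -/
theorem exists_pathGraph_four_embedding {V : Type*} (G : SimpleGraph V) {a b c d : V}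
    (hab : G.Adj a b) (hbc : G.Adj b c) (hcd : G.Adj c d)
    (hac : ¬ G.Adj a c) (hbd : ¬ G.Adj b d) (had : ¬ G.Adj a d)
    (hac' : a ≠ c) (hbd' : b ≠ d) (had' : a ≠ d) :
    ∃ f : SimpleGraph.pathGraph 4 ↪g G, Set.range f = {a, b, c, d} := by
  have hadj : ∀ i j, G.Adj (![a, b, c, d] i) (![a, b, c, d] j) ↔ (pathGraph 4).Adj i j := by
    intro i j
    fin_cases i <;> fin_cases j <;>
      simp [pathGraph_adj, hab, hbc, hcd, hac, hbd, had, hab.symm, hbc.symm, hcd.symm,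
        G.adj_comm c a, G.adj_comm d b, G.adj_comm d a]
  have hinj : Function.Injective ![a, b, c, d] := by
    intro i j
    fin_cases i <;> fin_cases j <;>
      simp [hab.ne, hbc.ne, hcd.ne, hac', hbd', had', hab.ne', hbc.ne', hcd.ne',
        hac'.symm, hbd'.symm, had'.symm]
  refine ⟨⟨⟨![a, b, c, d], hinj⟩, hadj _ _⟩, ?_⟩
  change Set.range ![a, b, c, d] = _
  ext v
  simp [eq_comm (a := v)]
  tauto

theorem P4_through_matched_cliques {V : Type*} [Fintype V] [DecidableEq V]
    (G : SimpleGraph V) (X Y : Finset V)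
    (hX : G.IsClique (X : Set V)) (hY : G.IsClique (Y : Set V))
    (hdisj : Disjoint X Y)
    (hmin : 2 ≤ min X.card Y.card) (hmax : 3 ≤ max X.card Y.card)
    (hne : ∃ x ∈ X, ∃ y ∈ Y, G.Adj x y)
    (hm1 : ∀ x ∈ X, ∀ y ∈ Y, ∀ y' ∈ Y, G.Adj x y → G.Adj x y' → y = y')
    (hm2 : ∀ y ∈ Y, ∀ x ∈ X, ∀ x' ∈ X, G.Adj x y → G.Adj x' y → x = x')
    (x : V) (hx : x ∈ X) (y : V) (hy : y ∈ Y) :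
    ∃ f : SimpleGraph.pathGraph 4 ↪g G,
      (∀ i, f i ∈ X ∪ Y) ∧ x ∈ Set.range f ∧ y ∈ Set.range f := by
  suffices h : ∃ a ∈ X, ∃ b ∈ X, ∃ c ∈ Y, ∃ d ∈ Y, a ≠ b ∧ c ≠ d ∧ G.Adj b c ∧ ¬ G.Adj a d ∧
      (x = a ∨ x = b) ∧ (y = c ∨ y = d) by
    obtain ⟨a, ha, b, hb, c, hc, d, hd, hab, hcd, hbc, had, hxab, hycd⟩ := h
    have hXY : ∀ u ∈ X, ∀ v ∈ Y, u ≠ v := fun u hu v hv =>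
      ne_of_mem_of_not_mem hu (Finset.disjoint_right.mp hdisj hv)
    obtain ⟨f, hf⟩ := exists_pathGraph_four_embedding G (hX ha hb hab) hbc (hY hc hd hcd)
      (fun h => hab (hm2 c hc a ha b hb h hbc)) (fun h => hcd (hm1 b hb c hc d hd hbc h)) had
      (hXY a ha c hc) (hXY b hb d hd) (hXY a ha d hd)
    refine ⟨f, fun i => ?_, ?_, ?_⟩
    · have hi : f i ∈ ({a, b, c, d} : Set V) := hf ▸ Set.mem_range_self i
      simp only [Set.mem_insert_iff, Set.mem_singleton_iff] at hi
      grind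
    · rw [hf]; grind
    · rw [hf]; grind
  obtain ⟨hX2, hY2⟩ := le_min_iff.mp hmin
  obtain ⟨a, ha, hax⟩ := X.exists_mem_ne hX2 x
  obtain ⟨d, hd, hdy⟩ := Y.exists_mem_ne hY2 y
  have third : ∀ (S : Finset V), 3 ≤ S.card → ∀ u v, ∃ w ∈ S, w ≠ u ∧ w ≠ v := by
    intro S hS u v
    obtain ⟨w, hw, hwuv⟩ := Finset.exists_mem_notMem_of_card_lt_card
      (lt_of_le_of_lt (Finset.card_le_two (a := u) (b := v)) hS)
    exact ⟨w, hw, by simpa using hwuv⟩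
  obtain ⟨u, hu, v, hv, huv⟩ := hne
  by_cases hxy : G.Adj x y
  · by_cases had : G.Adj a d
    · rcases le_max_iff.mp hmax with h | h
      · obtain ⟨w, hw, hwx, hwa⟩ := third X h x a
        exact ⟨w, hw, x, hx, y, hy, d, hd, hwx, hdy.symm, hxy,
          fun h => hwa (hm2 d hd w hw a ha h had), .inr rfl, .inl rfl⟩
      · obtain ⟨w, hw, hwy, hwd⟩ := third Y h y d
        exact ⟨a, ha, x, hx, y, hy, w, hw, hax, hwy.symm, hxy,
          fun h => hwd (hm1 a ha w hw d hd h had), .inr rfl, .inl rfl⟩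
    · exact ⟨a, ha, x, hx, y, hy, d, hd, hax, hdy.symm, hxy, had, .inr rfl, .inl rfl⟩
  by_cases hux : x = u
  · subst hux
    have hvy : v ≠ y := by rintro rfl; exact hxy huv
    by_cases hay : G.Adj a y
    · rcases le_max_iff.mp hmax with h | h
      · obtain ⟨w, hw, hwx, hwa⟩ := third X h x a
        exact ⟨w, hw, x, hx, v, hv, y, hy, hwx, hvy, huv,
          fun h => hwa (hm2 y hy w hw a ha h hay), .inr rfl, .inr rfl⟩
      · obtain ⟨w, hw, hwy, hwv⟩ := third Y h y v
        exact ⟨x, hx, a, ha, y, hy, w, hw, hax.symm, hwy.symm, hay,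
          fun h => hwv (hm1 x hx w hw v hv h huv), .inl rfl, .inl rfl⟩
    · exact ⟨a, ha, x, hx, v, hv, y, hy, hax, hvy, huv, hay, .inr rfl, .inr rfl⟩
  by_cases hvy : y = v
  · subst hvy
    by_cases hxd : G.Adj x d
    · rcases le_max_iff.mp hmax with h | h
      · obtain ⟨w, hw, hwx, hwu⟩ := third X h x u
        exact ⟨w, hw, x, hx, d, hd, y, hy, hwx, hdy, hxd,
          fun h => hwu (hm2 y hy w hw u hu h huv), .inr rfl, .inr rfl⟩
      · obtain ⟨w, hw, hwy, hwd⟩ := third Y h y d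
        exact ⟨x, hx, u, hu, y, hy, w, hw, hux, hwy.symm, huv,
          fun h => hwd (hm1 x hx w hw d hd h hxd), .inl rfl, .inl rfl⟩
    · exact ⟨x, hx, u, hu, y, hy, d, hd, hux, hdy.symm, huv, hxd, .inl rfl, .inl rfl⟩
  · exact ⟨x, hx, u, hu, v, hv, y, hy, hux, Ne.symm hvy, huv, hxy, .inl rfl, .inr rfl⟩
end

section
/- Let G be a finite simple (P2 ∪ P4, diamond)-free graph with ω(G) ≥ 4, let A be a maximum clique of G, and let k be the clique number of the graph G − A obtained by deleting the vertices of A. Then χ(G) ≤ max{2k, ω(G)}. -/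
open SimpleGraph

/-- `G` contains no induced path on four vertices. -/
def IsP4Free {V : Type*} (G : SimpleGraph V) : Prop :=
  ∀ a b c d, G.Adj a b → G.Adj b c → G.Adj c d → ¬G.Adj a c → ¬G.Adj b d → ¬G.Adj a d → False

lemma colorable_of_nat_coloring {V : Type*} {G : SimpleGraph V} {n : ℕ} (c : V → ℕ)
    (hlt : ∀ v, c v < n) (hc : ∀ u v, G.Adj u v → c u ≠ c v) : G.Colorable n :=
  ⟨Coloring.mk (fun v ↦ (⟨c v, hlt v⟩ : Fin n)) fun {u v} h e ↦
    hc u v h (congrArg Fin.val e)⟩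

/-- Every finite graph has a proper coloring in which each vertex sees every smaller color. -/
lemma exists_grundy_coloring {V : Type*} [Fintype V] (G : SimpleGraph V) :
    ∃ c : V → ℕ, (∀ u v, G.Adj u v → c u ≠ c v) ∧
      ∀ v, ∀ j < c v, ∃ u, G.Adj v u ∧ c u = j := by
  classical
  have hne : ∃ n, ∃ c : V → ℕ, (∀ u v, G.Adj u v → c u ≠ c v) ∧ ∑ v, c v = n :=
    ⟨_, fun v ↦ (Fintype.equivFin V v : ℕ),
      fun u v h e ↦ h.ne ((Fintype.equivFin V).injective (Fin.ext e)), rfl⟩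
  obtain ⟨c, hc, hsum⟩ := Nat.find_spec hne
  refine ⟨c, hc, fun v j hj ↦ ?_⟩
  by_contra! hno
  refine Nat.find_min hne (m := ∑ u, Function.update c v j u) ?_
    ⟨Function.update c v j, fun x y hxy ↦ ?_, rfl⟩
  · rw [← hsum]
    refine Finset.sum_lt_sum (fun u _ ↦ ?_) ⟨v, Finset.mem_univ _, by simpa using hj⟩
    by_cases h : u = v
    · subst h; simpa using hj.le
    · simp [h]
  · have := hc x y hxy
    have := hxy.ne
    by_cases hx : x = v <;> by_cases hy : y = v
    · simp_all
    · subst hx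
      simpa [hy] using (hno y hxy).symm
    · subst hy
      simpa [hx] using hno x hxy.symm
    · simpa [hx, hy] using hc x y hxy

/-- In a `P4`-free graph, a stable set dominating a nonempty clique contains a vertex complete to
that clique. -/
lemma IsP4Free.exists_complete {V : Type*} {G : SimpleGraph V} (hP : IsP4Free G)
    (S : Set V) (hS : ∀ u ∈ S, ∀ v ∈ S, ¬G.Adj u v) (Q : Finset V) (hQ : G.IsClique (Q : Set V))
    (hne : Q.Nonempty) (hdom : ∀ q ∈ Q, ∃ w ∈ S, G.Adj w q) :
    ∃ w ∈ S, ∀ q ∈ Q, G.Adj w q := by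
  classical
  induction hne using Finset.Nonempty.cons_induction with
  | singleton a =>
    obtain ⟨w, hw, h⟩ := hdom a (by simp)
    exact ⟨w, hw, by simpa using h⟩
  | cons x Q hx hne ih =>
    obtain ⟨w, hw, hwQ⟩ := ih (hQ.subset (by simp)) fun q hq ↦ hdom q (by simp [hq])
    obtain ⟨z, hz, hzx⟩ := hdom x (by simp)
    by_cases hwx : G.Adj w x
    · exact ⟨w, hw, by simpa [hwx] using hwQ⟩
    refine ⟨z, hz, ?_⟩
    simp only [Finset.mem_cons, forall_eq_or_imp]
    refine ⟨hzx, fun y hy ↦ ?_⟩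
    by_contra hzy
    have hyx : G.Adj y x := hQ (by simp [hy]) (by simp) (by rintro rfl; exact hx hy)
    exact hP w y x z (hwQ y hy) hyx hzx.symm hwx (fun h ↦ hzy h.symm) (hS w hw z hz)

lemma IsP4Free.colorable {V : Type*} [Fintype V] {G : SimpleGraph V} (hP : IsP4Free G) {k : ℕ}
    (hk : ∀ Q : Finset V, G.IsClique (Q : Set V) → Q.card ≤ k) : G.Colorable k := by
  classical
  obtain ⟨c, hc, hgr⟩ := exists_grundy_coloring G
  refine colorable_of_nat_coloring c (fun v ↦ ?_) hc
  have key : ∀ d ≤ c v, ∃ Q : Finset V, G.IsClique (Q : Set V) ∧ Q.card = d + 1 ∧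
      ∀ q ∈ Q, c v - d ≤ c q := by
    intro d
    induction d with
    | zero => exact fun _ ↦ ⟨{v}, by simp, by simp, by simp⟩
    | succ d ih =>
      intro hd
      obtain ⟨Q, hQ, hcard, hlow⟩ := ih (by omega)
      obtain ⟨w, hw, hwQ⟩ := hP.exists_complete {u | c u = c v - (d + 1)}
        (fun x hx y hy h ↦ hc x y h (hx.trans hy.symm)) Q hQ
        (Finset.card_pos.mp (by omega)) fun q hq ↦ by
          obtain ⟨u, hu, hcu⟩ := hgr q (c v - (d + 1)) (by have := hlow q hq; omega)
          exact ⟨u, hcu, hu.symm⟩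
      have hw' : c w = c v - (d + 1) := hw
      have hwn : w ∉ Q := fun h ↦ by have := hlow w h; omega
      refine ⟨insert w Q, ?_, by rw [Finset.card_insert_of_notMem hwn, hcard], ?_⟩
      · rw [Finset.coe_insert, isClique_insert]
        exact ⟨hQ, fun q hq _ ↦ hwQ q hq⟩
      · intro q hq
        rcases Finset.mem_insert.mp hq with rfl | hq
        · omega
        · have := hlow q hq; omega
  obtain ⟨Q, hQ, hcard, -⟩ := key (c v) le_rfl
  have := hk Q hQ
  omega

lemma diamond_false {V : Type*} {G : SimpleGraph V} (h : IsIndFree diamond G) {u v a b : V}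
    (huv : ¬G.Adj u v) (hne : u ≠ v) (hua : G.Adj u a) (hub : G.Adj u b) (hva : G.Adj v a)
    (hvb : G.Adj v b) (hab : G.Adj a b) : False := by
  have adj : ∀ i j, G.Adj (![u, v, a, b] i) (![u, v, a, b] j) ↔ diamond.Adj i j := by
    intro i j
    fin_cases i <;> fin_cases j <;> simp_all [diamond, G.adj_comm]
  refine h.false ⟨⟨![u, v, a, b], fun i j hij ↦ ?_⟩, adj _ _⟩
  have := hua.ne; have := hub.ne; have := hva.ne; have := hvb.ne; have := hab.ne
  fin_cases i <;> fin_cases j <;> simp_all [eq_comm]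

/-- The set of vertices anticomplete to both ends of an edge induces a `P4`-free graph. -/
lemma isP4Free_induce_of_anticomplete {V : Type*} {G : SimpleGraph V} (h : IsIndFree P2UP4 G)
    {x y : V} (hxy : G.Adj x y) {S : Set V} (hx : ∀ s ∈ S, ¬G.Adj s x)
    (hy : ∀ s ∈ S, ¬G.Adj s y) : IsP4Free (G.induce S) := by
  rintro ⟨a, ha⟩ ⟨b, hb⟩ ⟨c, hc⟩ ⟨d, hd⟩ hab hbc hcd hac hbd had
  simp only [comap_adj, Function.Embedding.subtype_apply] at hab hbc hcd hac hbd had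
  have hxa := hx a ha; have hxb := hx b hb; have hxc := hx c hc; have hxd := hx d hd
  have hya := hy a ha; have hyb := hy b hb; have hyc := hy c hc; have hyd := hy d hd
  have adj : ∀ i j, G.Adj (![x, y, a, b, c, d] i) (![x, y, a, b, c, d] j) ↔ P2UP4.Adj i j := by
    intro i j
    fin_cases i <;> fin_cases j <;> simp_all [P2UP4, G.adj_comm]
  refine h.false ⟨⟨![x, y, a, b, c, d], fun i j hij ↦ ?_⟩, adj _ _⟩
  have hrow : ∀ l, P2UP4.Adj i l ↔ P2UP4.Adj j l := fun l ↦ by rw [← adj, ← adj, hij]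
  revert hrow
  clear hij
  simp only [P2UP4, fromRel_adj]
  revert i j
  decide

lemma exists_nat_coloring_of_anticomplete {V : Type*} [Fintype V] {G : SimpleGraph V}
    (h : IsIndFree P2UP4 G) {x y : V} (hxy : G.Adj x y) {S T : Set V} (hST : S ⊆ T)
    (hx : ∀ s ∈ S, ¬G.Adj s x) (hy : ∀ s ∈ S, ¬G.Adj s y) :
    ∃ f : V → ℕ, (∀ v ∈ S, f v < (G.induce T).cliqueNum) ∧
      ∀ u ∈ S, ∀ v ∈ S, G.Adj u v → f u ≠ f v := by
  classical
  obtain ⟨C⟩ := (isP4Free_induce_of_anticomplete h hxy hx hy).colorable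
    (k := (G.induce T).cliqueNum) fun Q hQ ↦ by
      have hQ' : (G.induce T).IsClique
          (Q.map (G.induceHomOfLE hST).toEmbedding : Finset T) := by
        intro p hp q hq hpq
        simp only [Finset.coe_map, Set.mem_image] at hp hq
        obtain ⟨p, hp, rfl⟩ := hp
        obtain ⟨q, hq, rfl⟩ := hq
        exact hQ hp hq fun e ↦ hpq (by rw [e])
      simpa using hQ'.card_le_cliqueNum
  refine ⟨fun v ↦ if hv : v ∈ S then C ⟨v, hv⟩ else 0, fun v hv ↦ by simp [hv], ?_⟩
  intro u hu v hv huv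
  have : C ⟨u, hu⟩ ≠ C ⟨v, hv⟩ := C.valid (by simpa using huv)
  simpa [hu, hv, Fin.ext_iff] using this

/-- In a diamond-free graph, a vertex outside a maximum clique has at most one neighbor in it. -/
lemma eq_of_adj_maximum_clique {V : Type*} [Fintype V] {G : SimpleGraph V}
    (h : IsIndFree diamond G) {A : Finset V} (hA : G.IsClique (A : Set V))
    (hAmax : A.card = G.cliqueNum) {v a b : V} (hv : v ∉ A) (ha : a ∈ A) (hb : b ∈ A)
    (hva : G.Adj v a) (hvb : G.Adj v b) : a = b := by
  classical
  by_contra hab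
  obtain ⟨c, hc, hvc⟩ : ∃ c ∈ A, ¬G.Adj v c := by
    by_contra! hall
    have hcl : G.IsClique (insert v A : Finset V) := by
      rw [Finset.coe_insert, isClique_insert]
      exact ⟨hA, fun c hc _ ↦ hall c hc⟩
    have := hcl.card_le_cliqueNum
    rw [Finset.card_insert_of_notMem hv] at this
    omega
  exact diamond_false h hvc (by rintro rfl; exact hv hc) hva hvb
    (hA hc ha (by rintro rfl; exact hvc hva)) (hA hc hb (by rintro rfl; exact hvc hvb))
    (hA ha hb hab)

theorem chi_le_max_two_k_omega {V : Type*} [Fintype V] [DecidableEq V] (G : SimpleGraph V)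
    (h1 : IsIndFree P2UP4 G) (h2 : IsIndFree diamond G) (hw : 4 ≤ G.cliqueNum)
    (A : Finset V) (hA : G.IsClique (A : Set V)) (hAmax : A.card = G.cliqueNum) :
    G.chromaticNumber ≤
      ((max (2 * (G.induce ((A : Set V)ᶜ)).cliqueNum) G.cliqueNum : ℕ) : ℕ∞) := by
  classical
  set k := (G.induce ((A : Set V)ᶜ)).cliqueNum
  set w := G.cliqueNum
  have huniq {v a b : V} := eq_of_adj_maximum_clique h2 hA hAmax (v := v) (a := a) (b := b)
  obtain ⟨idx, hlt, hinj, hsurj⟩ : ∃ idx : V → ℕ, (∀ a ∈ A, idx a < w) ∧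
      (∀ a ∈ A, ∀ b ∈ A, idx a = idx b → a = b) ∧ ∀ i < w, ∃ a ∈ A, idx a = i := by
    let e : A ≃ Fin w := A.equivFinOfCardEq hAmax
    refine ⟨fun v ↦ if h : v ∈ A then e ⟨v, h⟩ else 0, fun a ha ↦ by simp [ha],
      fun a ha b hb hab ↦ ?_, fun i hi ↦ ⟨e.symm ⟨i, hi⟩, (e.symm ⟨i, hi⟩).2, by simp⟩⟩
    simpa [ha, hb, ← Fin.ext_iff] using hab
  have hpair : ∀ i j, i < w → j < w → i ≠ j →
      ∃ x ∈ A, ∃ y ∈ A, idx x = i ∧ idx y = j ∧ G.Adj x y := by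
    intro i j hi hj hij
    obtain ⟨x, hx, rfl⟩ := hsurj i hi
    obtain ⟨y, hy, rfl⟩ := hsurj j hj
    exact ⟨x, hx, y, hy, rfl, rfl, hA hx hy fun e ↦ hij (by rw [e])⟩
  refine Colorable.chromaticNumber_le ?_
  rcases le_or_gt k 1 with hk1 | hk2
  · have hind : ∀ u ∉ A, ∀ v ∉ A, ¬G.Adj u v := by
      intro u hu v hv huv
      have hcl : (G.induce ((A : Set V)ᶜ)).IsClique
          (({⟨u, hu⟩, ⟨v, hv⟩} : Finset ((A : Set V)ᶜ : Set V)) : Set _) := by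
        rw [Finset.coe_pair, isClique_pair]
        exact fun _ ↦ huv
      have := hcl.card_le_cliqueNum
      rw [Finset.card_pair (by simpa using huv.ne)] at this
      omega
    obtain ⟨x, hx, y, hy, -, -, hxy⟩ := hpair 0 1 (by omega) (by omega) (by omega)
    have hmix : ∀ u ∈ A, ∀ v ∉ A, G.Adj v u →
        idx u ≠ if G.Adj v x then idx y else idx x := by
      intro u hu v hv huv e
      split_ifs at e with hvx
      · exact hxy.ne (huniq hv hx hy hvx (hinj u hu y hy e ▸ huv))
      · exact hvx (hinj u hu x hx e ▸ huv)
    refine colorable_of_nat_coloring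
      (fun v ↦ if v ∈ A then idx v else if G.Adj v x then idx y else idx x) (fun v ↦ ?_) ?_
    · have := hlt x hx
      have := hlt y hy
      have := hlt v
      split_ifs <;> simp_all
    · intro u v huv
      by_cases hu : u ∈ A <;> by_cases hv : v ∈ A <;> simp only [hu, hv, if_true, if_false]
      · exact fun e ↦ huv.ne (hinj u hu v hv e)
      · exact hmix u hu v hv huv.symm
      · exact (hmix v hv u hu huv).symm
      · exact (hind u hu v hv huv).elim
  -- Split `A` at the index `p`; both resulting parts of the rest of the graph are `P4`-free.
  obtain ⟨p, hp2, hpw, hpk, hp⟩ :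
      ∃ p, 2 ≤ p ∧ p + 2 ≤ w ∧ p ≤ k ∧ (p = k ∨ w ≤ p + k) :=
    ⟨min k (w / 2), by omega, by omega, by omega, by omega⟩
  let S : Set V := {v | v ∉ A ∧ ∃ a ∈ A, idx a < p ∧ G.Adj v a}
  let T : Set V := {v | v ∉ A ∧ ¬∃ a ∈ A, idx a < p ∧ G.Adj v a}
  have hS : ∀ a ∈ A, p ≤ idx a → ∀ v ∈ S, ¬G.Adj v a := by
    rintro a ha hpa v ⟨hv, b, hb, hpb, hvb⟩ hva
    have := huniq hv ha hb hva hvb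
    subst this
    omega
  have hT : ∀ a ∈ A, idx a < p → ∀ v ∈ T, ¬G.Adj v a :=
    fun a ha hpa v hv hva ↦ hv.2 ⟨a, ha, hpa, hva⟩
  obtain ⟨f, hfk, hf⟩ : ∃ f : V → ℕ, (∀ v ∈ S, f v < k) ∧
      ∀ u ∈ S, ∀ v ∈ S, G.Adj u v → f u ≠ f v := by
    obtain ⟨x, hx, y, hy, hxi, hyi, hxy⟩ :=
      hpair p (p + 1) (by omega) (by omega) (by omega)
    exact exists_nat_coloring_of_anticomplete h1 hxy (fun v hv ↦ hv.1)
      (hS x hx (by omega)) (hS y hy (by omega))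
  obtain ⟨g, hgk, hg⟩ : ∃ g : V → ℕ, (∀ v ∈ T, g v < k) ∧
      ∀ u ∈ T, ∀ v ∈ T, G.Adj u v → g u ≠ g v := by
    obtain ⟨x, hx, y, hy, hxi, hyi, hxy⟩ := hpair 0 1 (by omega) (by omega) (by omega)
    exact exists_nat_coloring_of_anticomplete h1 hxy (fun v hv ↦ hv.1)
      (hT x hx (by omega)) (hT y hy (by omega))
  obtain ⟨c, hcA, hcS, hcT⟩ : ∃ c : V → ℕ,
      (∀ v ∈ A, c v = if idx v < p then k + idx v else
        if idx v < p + k then idx v - p else idx v) ∧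
      (∀ v ∈ S, c v = f v) ∧ ∀ v ∈ T, c v = k + g v := by
    refine ⟨fun v ↦ if v ∈ A then (if idx v < p then k + idx v else
        if idx v < p + k then idx v - p else idx v) else if v ∈ S then f v else k + g v,
      fun v hv ↦ by simp only [hv, if_true], fun v hv ↦ ?_, fun v hv ↦ ?_⟩
    · simp only [hv.1, hv, if_true, if_false]
    · have : v ∉ S := fun h ↦ hv.2 h.2
      simp only [hv.1, this, if_false]
  have htri : ∀ v, v ∈ A ∨ v ∈ S ∨ v ∈ T := by
    intro v
    by_cases hv : v ∈ A
    · exact .inl hv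
    · by_cases h : ∃ a ∈ A, idx a < p ∧ G.Adj v a
      · exact .inr (.inl ⟨hv, h⟩)
      · exact .inr (.inr ⟨hv, h⟩)
  have hAS : ∀ a ∈ A, ∀ v ∈ S, G.Adj v a → c v ≠ c a := by
    intro a ha v hv hva
    have hpa : idx a < p := by
      by_contra h
      exact hS a ha (by omega) v hv hva
    have := hfk v hv
    rw [hcA a ha, hcS v hv, if_pos hpa]
    omega
  have hAT : ∀ a ∈ A, ∀ v ∈ T, G.Adj v a → c v ≠ c a := by
    intro a ha v hv hva
    have hpa : ¬idx a < p := fun h ↦ hT a ha h v hv hva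
    have := hgk v hv
    have := hlt a ha
    rw [hcA a ha, hcT v hv, if_neg hpa]
    split_ifs <;> omega
  have hSTne : ∀ u ∈ S, ∀ v ∈ T, c u ≠ c v := by
    intro u hu v hv
    have := hfk u hu
    rw [hcS u hu, hcT v hv]
    omega
  refine colorable_of_nat_coloring c (fun v ↦ ?_) fun u v huv ↦ ?_
  · rcases htri v with hv | hv | hv
    · have := hlt v hv
      rw [hcA v hv]
      split_ifs <;> omega
    · have := hfk v hv
      rw [hcS v hv]
      omega
    · have := hgk v hv
      rw [hcT v hv]
      omega
  · rcases htri u with hu | hu | hu <;> rcases htri v with hv | hv | hv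
    · have hne : idx u ≠ idx v := fun e ↦ huv.ne (hinj u hu v hv e)
      have := hlt u hu
      have := hlt v hv
      rw [hcA u hu, hcA v hv]
      split_ifs <;> omega
    · exact (hAS u hu v hv huv.symm).symm
    · exact (hAT u hu v hv huv.symm).symm
    · exact hAS v hv u hu huv
    · rw [hcS u hu, hcS v hv]
      exact hf u hu v hv huv
    · exact hSTne u hu v hv
    · exact hAT v hv u hu huv
    · exact (hSTne v hv u hu).symm
    · rw [hcT u hu, hcT v hv]
      have := hg u hu v hv huv
      omega
end

section
/- Let G be a finite simple (P2 ∪ P4, diamond)-free graph with ω(G) = 3, let A be a maximum clique of G, and suppose the clique number of G − A is at most 2. Then χ(G) ≤ 6. -/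
open SimpleGraph

/-- A triangle-free graph without induced `P4` is 2-colorable. -/
theorem exists_two_coloring_of_no_triangle_of_no_P4 {W : Type*} (H : SimpleGraph W)
    (htri : ∀ a b c, H.Adj a b → H.Adj b c → ¬ H.Adj a c)
    (hpath : ∀ a b c d, H.Adj a b → H.Adj b c → H.Adj c d → a ≠ c → a ≠ d → b ≠ d →
      ¬ H.Adj a c → ¬ H.Adj a d → ¬ H.Adj b d → False) :
    ∃ f : W → Prop, ∀ u v, H.Adj u v → (f u ↔ ¬ f v) := by
  have near : ∀ r x, H.Reachable r x → x = r ∨ H.Adj r x ∨ ∃ y, H.Adj r y ∧ H.Adj y x := by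
    intro r x hx
    rw [reachable_iff_reflTransGen] at hx
    induction hx with
    | refl => exact Or.inl rfl
    | tail _ hbc ih =>
      rename_i b c _
      rcases ih with rfl | h | ⟨y, hry, hyb⟩
      · exact Or.inr (Or.inl hbc)
      · exact Or.inr (Or.inr ⟨b, h, hbc⟩)
      · by_contra! hcon
        obtain ⟨hcr, hrc, hno⟩ := hcon
        have hyc : ¬ H.Adj y c := hno y hry
        refine hpath r y b c hry hyb hbc ?_ (Ne.symm hcr) ?_ (htri r y b hry hyb) hrc hyc
        · rintro rfl
          exact hrc hbc
        · rintro rfl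
          exact hrc hry
  refine ⟨fun v => H.Adj (H.connectedComponentMk v).out v, fun u v huv => ?_⟩
  have hcomp : H.connectedComponentMk u = H.connectedComponentMk v :=
    ConnectedComponent.sound huv.reachable
  have hr : H.Reachable (H.connectedComponentMk v).out u := by
    rw [← hcomp]
    exact ConnectedComponent.exact (Quot.out_eq _)
  dsimp only
  rw [hcomp]
  generalize (H.connectedComponentMk v).out = r at hr
  refine ⟨fun h => fun h' => htri r u v h huv h', fun hrv => ?_⟩
  rcases near r u hr with rfl | h | ⟨y, hry, hyu⟩
  · exact absurd huv hrv
  · exact h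
  · by_contra hru
    refine hpath r y u v hry hyu huv ?_ ?_ ?_ hru hrv (htri y u v hyu huv)
    · rintro rfl
      exact hrv huv
    · rintro rfl
      exact hru huv.symm
    · rintro rfl
      exact hrv hry

theorem IsIndFree.not_P2_union_P4 {V : Type*} {G : SimpleGraph V} (h : IsIndFree P2UP4 G)
    {p q a b c d : V} (hpq : G.Adj p q)
    (hp : ∀ x ∈ [a, b, c, d], x ≠ p ∧ ¬ G.Adj x p) (hq : ∀ x ∈ [a, b, c, d], x ≠ q ∧ ¬ G.Adj x q)
    (hab : G.Adj a b) (hbc : G.Adj b c) (hcd : G.Adj c d) (nac : a ≠ c) (nad : a ≠ d) (nbd : b ≠ d)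
    (hac : ¬ G.Adj a c) (had : ¬ G.Adj a d) (hbd : ¬ G.Adj b d) : False := by
  simp only [List.mem_cons, List.not_mem_nil, or_false, forall_eq_or_imp, forall_eq] at hp hq
  have hinj : Function.Injective ![p, q, a, b, c, d] := by
    intro i j hij
    fin_cases i <;> fin_cases j <;>
      simp [hp, hq, hpq.ne, hpq.ne', hab.ne, hab.ne', hbc.ne, hbc.ne', hcd.ne, hcd.ne', nac,
        nac.symm, nad, nad.symm, nbd, nbd.symm] at hij ⊢ <;>
      grind
  refine h.false ⟨⟨![p, q, a, b, c, d], hinj⟩, fun {i j} => ?_⟩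
  change G.Adj (![p, q, a, b, c, d] i) (![p, q, a, b, c, d] j) ↔ P2UP4.Adj i j
  fin_cases i <;> fin_cases j <;>
    simp [P2UP4, hp, hq, hpq, hpq.symm, hab, hab.symm, hbc, hbc.symm, hcd, hcd.symm, hac, had, hbd,
      mt SimpleGraph.Adj.symm hac, mt SimpleGraph.Adj.symm had, mt SimpleGraph.Adj.symm hbd] <;>
    grind [SimpleGraph.adj_comm]

theorem IsIndFree.not_diamond {V : Type*} {G : SimpleGraph V} (h : IsIndFree diamond G)
    {a b c d : V} (nab : a ≠ b) (hab : ¬ G.Adj a b) (hac : G.Adj a c) (had : G.Adj a d)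
    (hbc : G.Adj b c) (hbd : G.Adj b d) (hcd : G.Adj c d) : False := by
  have hinj : Function.Injective ![a, b, c, d] := by
    intro i j hij
    fin_cases i <;> fin_cases j <;>
      simp [hac.ne, hac.ne', had.ne, had.ne', hbc.ne, hbc.ne', hbd.ne, hbd.ne', hcd.ne, hcd.ne',
        nab, nab.symm] at hij ⊢
  refine h.false ⟨⟨![a, b, c, d], hinj⟩, fun {i j} => ?_⟩
  change G.Adj (![a, b, c, d] i) (![a, b, c, d] j) ↔ diamond.Adj i j
  fin_cases i <;> fin_cases j <;>
    simp [diamond, hab, mt SimpleGraph.Adj.symm hab, hac, hac.symm, had, had.symm, hbc, hbc.symm, hbd, hbd.symm,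
      hcd, hcd.symm]

/-- In a `P2 ∪ P4`-free graph, the vertices anticomplete to an edge `pq` induce a bipartite graph
as soon as they lie in a triangle-free part. -/
theorem IsIndFree.exists_two_coloring_anticomplete {V : Type*} {G : SimpleGraph V}
    (h : IsIndFree P2UP4 G) {T : Set V}
    (htri : ∀ a ∈ T, ∀ b ∈ T, ∀ c ∈ T, G.Adj a b → G.Adj b c → ¬ G.Adj a c)
    {p q : V} (hp : p ∉ T) (hq : q ∉ T) (hpq : G.Adj p q) :
    ∃ f : V → Prop, ∀ u ∈ T, ∀ v ∈ T, ¬ G.Adj u p → ¬ G.Adj u q → ¬ G.Adj v p → ¬ G.Adj v q →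
      G.Adj u v → (f u ↔ ¬ f v) := by
  let S : Set V := {v | v ∈ T ∧ ¬ G.Adj v p ∧ ¬ G.Adj v q}
  have hSp : ∀ x : S, x.1 ≠ p ∧ ¬ G.Adj x p := fun x =>
    ⟨fun e => hp (e ▸ x.2.1), x.2.2.1⟩
  have hSq : ∀ x : S, x.1 ≠ q ∧ ¬ G.Adj x q := fun x =>
    ⟨fun e => hq (e ▸ x.2.1), x.2.2.2⟩
  obtain ⟨f, hf⟩ := exists_two_coloring_of_no_triangle_of_no_P4 (G.induce S)
    (fun a b c => htri a a.2.1 b b.2.1 c c.2.1)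
    (fun a b c d hab hbc hcd nac nad nbd hac had hbd =>
      h.not_P2_union_P4 (a := a.1) (b := b.1) (c := c.1) (d := d.1) hpq
        (by simp [hSp]) (by simp [hSq]) hab hbc hcd
        (Subtype.coe_ne_coe.2 nac) (Subtype.coe_ne_coe.2 nad) (Subtype.coe_ne_coe.2 nbd)
        hac had hbd)
  refine ⟨fun v => ∃ hv : v ∈ S, f ⟨v, hv⟩, fun u hu v hv hup huq hvp hvq huv => ?_⟩
  have hu' : u ∈ S := ⟨hu, hup, huq⟩
  have hv' : v ∈ S := ⟨hv, hvp, hvq⟩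
  simpa [hu', hv'] using hf ⟨u, hu'⟩ ⟨v, hv'⟩ huv

theorem chi_le_six_of_omega_three_k_le_two {V : Type*} [Fintype V] [DecidableEq V]
    (G : SimpleGraph V)
    (h1 : IsIndFree P2UP4 G) (h2 : IsIndFree diamond G) (hw : G.cliqueNum = 3)
    (A : Finset V) (hA : G.IsClique (A : Set V)) (hAmax : A.card = G.cliqueNum)
    (hk : (G.induce ((A : Set V)ᶜ)).cliqueNum ≤ 2) :
    G.chromaticNumber ≤ 6 := by
  classical
  obtain ⟨x, y, z, hxy, hxz, hyz, rfl⟩ := is3Clique_iff.1 ⟨hA, hAmax.trans hw⟩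
  have hK4 : ∀ v, G.Adj v x → G.Adj v y → G.Adj v z → False := by
    intro v hx hy hz
    have hcl : G.IsNClique 4 (insert v {x, y, z}) :=
      (is3Clique_triple_iff.2 ⟨hxy, hxz, hyz⟩).insert (by simp [hx, hy, hz])
    have := hcl.1.card_le_cliqueNum
    rw [hcl.2, hw] at this
    omega
  let T : Set V := ((({x, y, z} : Finset V) : Set V))ᶜ
  have hT : ∀ v, v ∈ T ↔ v ≠ x ∧ v ≠ y ∧ v ≠ z := by simp [T]
  have htri : ∀ a ∈ T, ∀ b ∈ T, ∀ c ∈ T, G.Adj a b → G.Adj b c → ¬ G.Adj a c := by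
    intro a ha b hb c hc hab hbc hac
    have hcl : (G.induce T).IsNClique 3 {⟨a, ha⟩, ⟨b, hb⟩, ⟨c, hc⟩} :=
      is3Clique_triple_iff.2 ⟨hab, hac, hbc⟩
    have := hcl.1.card_le_cliqueNum
    rw [hcl.2] at this
    exact absurd (this.trans hk) (by norm_num)
  have hx : x ∉ T := by simp [T]
  have hy : y ∉ T := by simp [T]
  have hz : z ∉ T := by simp [T]
  have hxy' : ∀ v ∈ T, G.Adj v x → ¬ G.Adj v y := fun v hv h h' =>
    h2.not_diamond (b := z) (fun e => hz (e ▸ hv)) (hK4 v h h') h h' hxz.symm hyz.symm hxy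
  have hxz' : ∀ v ∈ T, G.Adj v x → ¬ G.Adj v z := fun v hv h h' =>
    h2.not_diamond (b := y) (fun e => hy (e ▸ hv)) (fun e => hK4 v h e h') h h' hxy.symm hyz hxz
  have hyz' : ∀ v ∈ T, G.Adj v y → ¬ G.Adj v z := fun v hv h h' =>
    h2.not_diamond (b := x) (fun e => hx (e ▸ hv)) (fun e => hK4 v e h h') h h' hxy hxz hyz
  obtain ⟨f, hf⟩ := h1.exists_two_coloring_anticomplete htri hy hz hyz
  obtain ⟨g, hg⟩ := h1.exists_two_coloring_anticomplete htri hx hz hxz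
  obtain ⟨k, hk'⟩ := h1.exists_two_coloring_anticomplete htri hx hy hxy
  let col : V → Fin 3 × Prop := fun v =>
    if v = x then (1, True) else if v = y then (2, True) else if v = z then (0, True)
    else if G.Adj v y then (1, g v) else if G.Adj v z then (2, k v) else (0, f v)
  have hcol : ∀ u v, G.Adj u v → col u ≠ col v := by
    intro u v huv
    have hne := huv.ne
    have := hT u
    have := hT v
    have := huv.symm
    have := hxy.ne
    have := hxz.ne
    have := hyz.ne
    simp only [col]
    split_ifs <;> simp only [ne_eq, Prod.mk.injEq, not_and, eq_iff_iff] <;> grind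
  have hc : G.Colorable (Fintype.card (Fin 3 × Prop)) :=
    (Coloring.mk col fun {u v} => hcol u v).colorable
  have h6 : G.Colorable 6 := by simpa using hc
  exact_mod_cast h6.chromaticNumber_le
end

section
/- Let G be a finite simple (P2 ∪ P4, diamond)-free graph with ω(G) ≥ 3, let A be a maximum clique of G, let H = G − A, and let k = ω(H) with k ≥ 3. If H contains a clique of size k whose vertex set is anticomplete to A (no vertex of the clique has a neighbour in A), then χ(G) = ω(G). -/
open SimpleGraph

theorem Finset.exists_injOn_extend {α β : Type*} [Fintype β] [DecidableEq β] {s C : Finset α}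
    (hsC : s ⊆ C) {φ : α → β} (hφ : Set.InjOn φ s) (hcard : C.card ≤ Fintype.card β) :
    ∃ ψ : α → β, Set.InjOn ψ C ∧ ∀ x ∈ s, ψ x = φ x := by
  classical
  obtain ⟨t, hst, -, ht⟩ := Finset.exists_subsuperset_card_eq (Finset.subset_univ (s.image φ))
    (n := C.card) (Finset.card_image_le.trans (Finset.card_le_card hsC)) (by simpa using hcard)
  obtain ⟨g, hg⟩ := Finset.exists_equiv_extend_of_card_eq (α := C) (t := t)
    (by simpa using ht.symm) (s := s.subtype (· ∈ C)) (f := fun x => φ x)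
    (by
      intro y hy
      obtain ⟨x, hx, rfl⟩ := Finset.mem_image.1 hy
      exact hst (Finset.mem_image_of_mem φ (Finset.mem_subtype.1 hx)))
    (by
      intro x hx y hy hxy
      simp only [Finset.mem_coe, Finset.mem_subtype] at hx hy
      exact Subtype.ext (hφ hx hy hxy))
  refine ⟨fun x => if hx : x ∈ C then g ⟨x, hx⟩ else φ x, ?_, ?_⟩
  · intro x hx y hy hxy
    rw [Finset.mem_coe] at hx hy
    simp only [hx, hy, dif_pos] at hxy
    simpa using g.injective (Subtype.ext hxy)
  · intro x hx
    simp only [hsC hx, dif_pos]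
    exact hg ⟨x, hsC hx⟩ (Finset.mem_subtype.2 hx)

namespace SimpleGraph

variable {V : Type*} {G : SimpleGraph V}

theorem not_p2UP4_of_isIndFree (h : IsIndFree P2UP4 G) {p q a b c d : V}
    (hpq : G.Adj p q) (hab : G.Adj a b) (hbc : G.Adj b c) (hcd : G.Adj c d)
    (hac : ¬ G.Adj a c) (had : ¬ G.Adj a d) (hbd : ¬ G.Adj b d)
    (hpa : ¬ G.Adj p a) (hpb : ¬ G.Adj p b) (hpc : ¬ G.Adj p c) (hpd : ¬ G.Adj p d)
    (hqa : ¬ G.Adj q a) (hqb : ¬ G.Adj q b) (hqc : ¬ G.Adj q c) (hqd : ¬ G.Adj q d) :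
    False := by
  have key : ∀ i j, G.Adj (![p, q, a, b, c, d] i) (![p, q, a, b, c, d] j) ↔ P2UP4.Adj i j := by
    intro i j
    fin_cases i <;> fin_cases j <;> simp [P2UP4, *, G.adj_comm]
  refine h.false ⟨⟨![p, q, a, b, c, d], ?_⟩, fun {i j} => key i j⟩
  intro i j hij
  have hN : ∀ k, P2UP4.Adj i k ↔ P2UP4.Adj j k := fun k => by rw [← key, ← key, hij]
  revert hN
  fin_cases i <;> fin_cases j <;> simp [P2UP4, Fin.forall_fin_succ]

theorem adj_of_diamond_isIndFree (h : IsIndFree diamond G) {x y u v : V} (hxy : x ≠ y)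
    (huv : G.Adj u v) (hxu : G.Adj x u) (hxv : G.Adj x v) (hyu : G.Adj y u) (hyv : G.Adj y v) :
    G.Adj x y := by
  by_contra hn
  have key : ∀ i j, G.Adj (![x, y, u, v] i) (![x, y, u, v] j) ↔ diamond.Adj i j := by
    intro i j
    fin_cases i <;> fin_cases j <;> simp [diamond, *, G.adj_comm]
  refine h.false ⟨⟨![x, y, u, v], ?_⟩, fun {i j} => key i j⟩
  intro i j hij
  have := hxu.ne
  have := hxv.ne
  have := hyu.ne
  have := hyv.ne
  have := huv.ne
  fin_cases i <;> fin_cases j <;> simp_all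

/-- In a graph with no induced `P4`, every maximal independent set meets every maximal clique. -/
theorem exists_mem_of_maximal_indep_of_maximal_clique {W S K : Finset V}
    (hP4 : ∀ a ∈ W, ∀ b ∈ W, ∀ c ∈ W, ∀ d ∈ W, G.Adj a b → G.Adj b c → G.Adj c d →
      ¬ G.Adj a c → ¬ G.Adj b d → G.Adj a d)
    (hSW : S ⊆ W) (hS : ∀ x ∈ S, ∀ y ∈ S, ¬ G.Adj x y)
    (hSmax : ∀ x ∈ W, x ∉ S → ∃ y ∈ S, G.Adj x y)
    (hKW : K ⊆ W) (hK0 : K.Nonempty) (hK : G.IsClique (K : Set V))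
    (hKmax : ∀ x ∈ W, x ∉ K → ∃ y ∈ K, ¬ G.Adj x y) : ∃ x ∈ S, x ∈ K := by
  classical
  by_contra! hdis
  obtain ⟨k₀, hk₀⟩ := hK0
  have hne : S.Nonempty := by
    obtain ⟨y, hy, -⟩ := hSmax k₀ (hKW hk₀) fun h => hdis _ h hk₀
    exact ⟨y, hy⟩
  obtain ⟨s, hs, hmax⟩ := S.exists_max_image (fun s => (K.filter (G.Adj s)).card) hne
  obtain ⟨k, hk, hsk⟩ := hKmax s (hSW hs) (hdis s hs)
  obtain ⟨s', hs', hks'⟩ := hSmax k (hKW hk) fun h => hdis _ h hk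
  obtain ⟨k', hk', hsk', hs'k'⟩ : ∃ k' ∈ K, G.Adj s k' ∧ ¬ G.Adj s' k' := by
    by_contra! hcon
    refine (Finset.card_lt_card ?_).not_ge (hmax s' hs')
    refine Finset.ssubset_iff_of_subset ?_ |>.2 ⟨k, ?_, ?_⟩
    · intro x hx
      rw [Finset.mem_filter] at hx ⊢
      exact ⟨hx.1, hcon x hx.1 hx.2⟩
    · simp [hk, hks'.symm]
    · simp [hsk]
  have hkk' : k' ≠ k := by
    rintro rfl
    exact hsk hsk'
  exact hS s hs s' hs' (hP4 s (hSW hs) k' (hKW hk') k (hKW hk) s' (hSW hs') hsk'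
    (hK hk' hk hkk') hks' hsk (fun h => hs'k' h.symm))

/-- A set with no induced `P4` can be properly coloured from any palette at least as large as
its cliques. -/
theorem exists_coloring_of_p4_free {α : Type*} (P : Finset α) [Nonempty α] :
    ∀ W : Finset V,
      (∀ a ∈ W, ∀ b ∈ W, ∀ c ∈ W, ∀ d ∈ W, G.Adj a b → G.Adj b c → G.Adj c d →
        ¬ G.Adj a c → ¬ G.Adj b d → G.Adj a d) →
      (∀ K ⊆ W, G.IsClique (K : Set V) → K.card ≤ P.card) →
      ∃ f : V → α, (∀ v ∈ W, f v ∈ P) ∧ ∀ u ∈ W, ∀ v ∈ W, G.Adj u v → f u ≠ f v := by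
  classical
  induction P using Finset.induction with
  | empty =>
    intro W _ hW
    have hempty : W = ∅ := by
      by_contra hne
      obtain ⟨w, hw⟩ := Finset.nonempty_iff_ne_empty.2 hne
      simpa using hW {w} (by simpa using hw) (by simp)
    subst hempty
    exact ⟨fun _ => Classical.arbitrary α, by simp, by simp⟩
  | insert p P hp ih =>
    intro W hP4 hW
    rw [Finset.card_insert_of_notMem hp] at hW
    obtain ⟨S, hSmem, hSmax⟩ := (W.powerset.filter
      fun S => ∀ x ∈ S, ∀ y ∈ S, ¬ G.Adj x y).exists_max_image Finset.card ⟨∅, by simp⟩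
    simp only [Finset.mem_filter, Finset.mem_powerset] at hSmem hSmax
    obtain ⟨hSW, hS⟩ := hSmem
    have hSdom : ∀ x ∈ W, x ∉ S → ∃ y ∈ S, G.Adj x y := by
      intro x hx hxS
      by_contra! hcon
      have := hSmax (insert x S) ⟨Finset.insert_subset hx hSW, by
        intro y hy z hz hyz
        rw [Finset.mem_insert] at hy hz
        rcases hy with rfl | hy <;> rcases hz with rfl | hz
        · exact G.irrefl hyz
        · exact hcon z hz hyz
        · exact hcon y hy hyz.symm
        · exact hS y hy z hz hyz⟩
      rw [Finset.card_insert_of_notMem hxS] at this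
      omega
    obtain ⟨f, hfP, hf⟩ := ih (W \ S)
      (fun a ha b hb c hc d hd => hP4 a (Finset.mem_sdiff.1 ha).1 b (Finset.mem_sdiff.1 hb).1
        c (Finset.mem_sdiff.1 hc).1 d (Finset.mem_sdiff.1 hd).1) (by
      intro K hKW hK
      by_contra! hlt
      have hKW' : K ⊆ W := hKW.trans Finset.sdiff_subset
      obtain ⟨x, hxS, hxK⟩ := exists_mem_of_maximal_indep_of_maximal_clique hP4 hSW hS hSdom hKW'
        (Finset.card_pos.1 (by omega)) hK (by
          intro x hx hxK
          by_contra! hcon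
          have := hW (insert x K) (Finset.insert_subset hx hKW') (by
            rw [Finset.coe_insert]
            exact hK.insert fun y hy _ => hcon y hy)
          rw [Finset.card_insert_of_notMem hxK] at this
          omega)
      exact (Finset.mem_sdiff.1 (hKW hxK)).2 hxS)
    refine ⟨fun v => if v ∈ S then p else f v, ?_, ?_⟩
    · intro v hv
      by_cases hvS : v ∈ S
      · simp [hvS]
      · simp [hvS, hfP v (Finset.mem_sdiff.2 ⟨hv, hvS⟩)]
    · intro u hu v hv huv
      by_cases huS : u ∈ S <;> by_cases hvS : v ∈ S
      · exact absurd huv (hS u huS v hvS)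
      · have := hfP v (Finset.mem_sdiff.2 ⟨hv, hvS⟩)
        simp only [huS, hvS, if_true, if_false]
        rintro rfl
        exact hp this
      · have := hfP u (Finset.mem_sdiff.2 ⟨hu, huS⟩)
        simp only [huS, hvS, if_true, if_false]
        rintro rfl
        exact hp this
      · simp only [huS, hvS, if_false]
        exact hf u (Finset.mem_sdiff.2 ⟨hu, huS⟩) v (Finset.mem_sdiff.2 ⟨hv, hvS⟩) huv

/-- Two anticomplete cliques on at least three vertices each, such that every other vertex has at
most one neighbour in either of them. -/
structure IsAnticompletePair (G : SimpleGraph V) (A C : Finset V) : Prop where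
  isClique_left : G.IsClique (A : Set V)
  isClique_right : G.IsClique (C : Set V)
  disjoint : Disjoint A C
  card_left : 3 ≤ A.card
  card_right : 3 ≤ C.card
  anti : ∀ a ∈ A, ∀ c ∈ C, ¬ G.Adj a c
  eq_left : ∀ v ∉ A, ∀ a ∈ A, ∀ b ∈ A, G.Adj v a → G.Adj v b → a = b
  eq_right : ∀ v ∉ C, ∀ a ∈ C, ∀ b ∈ C, G.Adj v a → G.Adj v b → a = b

namespace IsAnticompletePair

variable {A C : Finset V}

theorem symm (h : G.IsAnticompletePair A C) : G.IsAnticompletePair C A :=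
  ⟨h.isClique_right, h.isClique_left, h.disjoint.symm, h.card_right, h.card_left,
    fun c hc a ha hca => h.anti a ha c hc hca.symm, h.eq_right, h.eq_left⟩

theorem exists_adj_right (h : G.IsAnticompletePair A C) (h1 : IsIndFree P2UP4 G) {u v a : V}
    (huA : u ∉ A) (huC : u ∉ C) (hvA : v ∉ A) (hvC : v ∉ C) (huv : G.Adj u v)
    (ha : a ∈ A) (hua : G.Adj u a) (hva : ¬ G.Adj v a) :
    ∃ c ∈ C, ∃ c' ∈ C, G.Adj u c ∧ G.Adj v c' ∧ c ≠ c' := by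
  classical
  by_contra! hcon
  obtain ⟨m, hm, hma, hvm⟩ : ∃ m ∈ A, m ≠ a ∧ ¬ G.Adj v m := by
    have hcard : 1 < (A.erase a).card := by
      rw [Finset.card_erase_of_mem ha]
      have := h.card_left
      omega
    obtain ⟨m, hm, m', hm', hne⟩ := Finset.one_lt_card.1 hcard
    rw [Finset.mem_erase] at hm hm'
    by_cases hvm : G.Adj v m
    · exact ⟨m', hm'.2, hm'.1, fun hvm' => hne (h.eq_left v hvA m hm.2 m' hm'.2 hvm hvm')⟩
    · exact ⟨m, hm.2, hm.1, hvm⟩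
  have hle : (C.filter fun x => G.Adj u x ∨ G.Adj v x).card ≤ 1 := by
    rw [Finset.card_le_one]
    intro x hx y hy
    rw [Finset.mem_filter] at hx hy
    obtain ⟨hx, hx' | hx'⟩ := hx <;> obtain ⟨hy, hy' | hy'⟩ := hy
    · exact h.eq_right u huC x hx y hy hx' hy'
    · exact hcon x hx y hy hx' hy'
    · exact (hcon y hy x hx hy' hx').symm
    · exact h.eq_right v hvC x hx y hy hx' hy'
  have hlt : 1 < (C.filter fun x => ¬ (G.Adj u x ∨ G.Adj v x)).card := by
    have := C.card_filter_add_card_filter_not (fun x => G.Adj u x ∨ G.Adj v x)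
    have := h.card_right
    omega
  obtain ⟨p, hp, q, hq, hpq⟩ := Finset.one_lt_card.1 hlt
  simp only [Finset.mem_filter, not_or] at hp hq
  exact not_p2UP4_of_isIndFree h1 (h.isClique_right hp.1 hq.1 hpq) huv.symm hua
    (h.isClique_left ha hm hma.symm) hva hvm
    (fun hum => hma (h.eq_left u huA m hm a ha hum hua))
    (fun e => hp.2.2 e.symm) (fun e => hp.2.1 e.symm) (fun e => h.anti a ha p hp.1 e.symm)
    (fun e => h.anti m hm p hp.1 e.symm)
    (fun e => hq.2.2 e.symm) (fun e => hq.2.1 e.symm) (fun e => h.anti a ha q hq.1 e.symm)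
    (fun e => h.anti m hm q hq.1 e.symm)

theorem left_eq_of_common_right (h : G.IsAnticompletePair A C) (h1 : IsIndFree P2UP4 G)
    {x y a a' c : V} (hxA : x ∉ A) (hxC : x ∉ C) (hyA : y ∉ A) (hyC : y ∉ C)
    (hc : c ∈ C) (hxc : G.Adj x c) (hyc : G.Adj y c)
    (ha : a ∈ A) (ha' : a' ∈ A) (hxa : G.Adj x a) (hya' : G.Adj y a') : a = a' := by
  classical
  by_contra hne
  have hya : ¬ G.Adj y a := fun hya => hne (h.eq_left y hyA a ha a' ha' hya hya')
  have hxa' : ¬ G.Adj x a' := fun hxa' => hne (h.eq_left x hxA a ha a' ha' hxa hxa')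
  by_cases hxy : G.Adj x y
  · obtain ⟨d, hd, d', hd', hxd, hyd', hdd'⟩ :=
      h.exists_adj_right h1 hxA hxC hyA hyC hxy ha hxa hya
    exact hdd' ((h.eq_right x hxC d hd c hc hxd hxc).trans
      (h.eq_right y hyC c hc d' hd' hyc hyd'))
  · have hcard : 1 < (C.erase c).card := by
      rw [Finset.card_erase_of_mem hc]
      have := h.card_right
      omega
    obtain ⟨p, hp, q, hq, hpq⟩ := Finset.one_lt_card.1 hcard
    rw [Finset.mem_erase] at hp hq
    exact not_p2UP4_of_isIndFree h1 (h.isClique_right hp.2 hq.2 hpq) hxa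
      (h.isClique_left ha ha' hne) hya'.symm hxa' hxy (fun e => hya e.symm)
      (fun e => hp.1 (h.eq_right x hxC p hp.2 c hc e.symm hxc))
      (fun e => h.anti a ha p hp.2 e.symm) (fun e => h.anti a' ha' p hp.2 e.symm)
      (fun e => hp.1 (h.eq_right y hyC p hp.2 c hc e.symm hyc))
      (fun e => hq.1 (h.eq_right x hxC q hq.2 c hc e.symm hxc))
      (fun e => h.anti a ha q hq.2 e.symm) (fun e => h.anti a' ha' q hq.2 e.symm)
      (fun e => hq.1 (h.eq_right y hyC q hq.2 c hc e.symm hyc))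

theorem exists_adj_both_of_left (h : G.IsAnticompletePair A C) (h1 : IsIndFree P2UP4 G) {u v a : V}
    (huA : u ∉ A) (huC : u ∉ C) (hvA : v ∉ A) (hvC : v ∉ C) (huv : G.Adj u v)
    (ha : a ∈ A) (hua : G.Adj u a) (hva : ¬ G.Adj v a) :
    (∃ a ∈ A, ∃ c ∈ C, G.Adj u a ∧ G.Adj u c) ∧ (∃ a ∈ A, ∃ c ∈ C, G.Adj v a ∧ G.Adj v c) := by
  obtain ⟨c, hc, c', hc', huc, hvc', hne⟩ :=
    h.exists_adj_right h1 huA huC hvA hvC huv ha hua hva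
  obtain ⟨a', ha', -, -, hva', -, -⟩ := h.symm.exists_adj_right h1 hvC hvA huC huA huv.symm hc' hvc'
    (fun e => hne (h.eq_right u huC c hc c' hc' huc e))
  exact ⟨⟨a, ha, c, hc, hua, huc⟩, ⟨a', ha', c', hc', hva', hvc'⟩⟩

/-- Adjacent vertices outside an anticomplete pair have the same neighbours in it, unless both
have neighbours in both cliques. -/
theorem filter_adj_eq_or [DecidableEq V] [DecidableRel G.Adj] (h : G.IsAnticompletePair A C)
    (h1 : IsIndFree P2UP4 G) {u v : V}
    (huA : u ∉ A) (huC : u ∉ C) (hvA : v ∉ A) (hvC : v ∉ C) (huv : G.Adj u v) :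
    (A.filter (G.Adj u) = A.filter (G.Adj v) ∧ C.filter (G.Adj u) = C.filter (G.Adj v)) ∨
    ((∃ a ∈ A, ∃ c ∈ C, G.Adj u a ∧ G.Adj u c) ∧ (∃ a ∈ A, ∃ c ∈ C, G.Adj v a ∧ G.Adj v c)) := by
  by_contra! hcon
  obtain ⟨hcon, hboth⟩ := hcon
  have swap : ∀ {w : V}, (∃ c ∈ C, ∃ a ∈ A, G.Adj w c ∧ G.Adj w a) →
      ∃ a ∈ A, ∃ c ∈ C, G.Adj w a ∧ G.Adj w c := by
    rintro w ⟨c, hc, a, ha, hwc, hwa⟩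
    exact ⟨a, ha, c, hc, hwa, hwc⟩
  have hn : ¬ ((∃ a ∈ A, ∃ c ∈ C, G.Adj u a ∧ G.Adj u c) ∧
      (∃ a ∈ A, ∃ c ∈ C, G.Adj v a ∧ G.Adj v c)) := by
    rintro ⟨hu, a, ha, c, hc, hva, hvc⟩
    exact hboth hu a ha c hc hva hvc
  refine hcon (Finset.filter_congr fun a ha => ⟨fun hua => ?_, fun hva => ?_⟩)
    (Finset.filter_congr fun c hc => ⟨fun huc => ?_, fun hvc => ?_⟩) <;> by_contra hne
  · exact hn (h.exists_adj_both_of_left h1 huA huC hvA hvC huv ha hua hne)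
  · exact hn (h.exists_adj_both_of_left h1 hvA hvC huA huC huv.symm ha hva hne).symm
  · exact hn ((h.symm.exists_adj_both_of_left h1 huC huA hvC hvA huv hc huc hne).imp swap swap)
  · exact hn ((h.symm.exists_adj_both_of_left h1 hvC hvA huC huA huv.symm hc hvc hne).symm.imp
      swap swap)

theorem not_adj_of_common_left_right (h : G.IsAnticompletePair A C) (h2 : IsIndFree diamond G)
    {u v a c : V} (ha : a ∈ A) (hc : c ∈ C) (hua : G.Adj u a) (hva : G.Adj v a)
    (huc : G.Adj u c) (hvc : G.Adj v c) : ¬ G.Adj u v := fun huv =>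
  h.anti a ha c hc (adj_of_diamond_isIndFree h2 (h.disjoint.forall_ne_finset ha hc) huv
    hua.symm hva.symm huc.symm hvc.symm)

/-- The two cliques can be coloured injectively so that the two neighbours in them of any outside
vertex adjacent to both receive the same colour. -/
theorem exists_linked_coloring (h : G.IsAnticompletePair A C) (h1 : IsIndFree P2UP4 G)
    {α : Type*} [Fintype α] [Nonempty α] (hA : A.card ≤ Fintype.card α)
    (hC : C.card ≤ Fintype.card α) :
    ∃ f : V → α, Set.InjOn f A ∧ Set.InjOn f C ∧
      ∀ x ∉ A, x ∉ C → ∀ a ∈ A, ∀ c ∈ C, G.Adj x a → G.Adj x c → f c = f a := by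
  classical
  obtain ⟨fA, hfA, -⟩ := Finset.exists_injOn_extend (Finset.empty_subset A)
    (φ := fun _ => Classical.arbitrary α) (by simp) hA
  have hlink : ∀ c, ∃ a, (∃ a ∈ A, ∃ x ∉ A, x ∉ C ∧ G.Adj x a ∧ G.Adj x c) →
      a ∈ A ∧ ∃ x ∉ A, x ∉ C ∧ G.Adj x a ∧ G.Adj x c := by
    intro c
    by_cases hc : ∃ a ∈ A, ∃ x ∉ A, x ∉ C ∧ G.Adj x a ∧ G.Adj x c
    · obtain ⟨a, ha⟩ := hc
      exact ⟨a, fun _ => ha⟩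
    · exact ⟨c, fun h => absurd h hc⟩
  choose link hlink using hlink
  obtain ⟨fC, hfC, hfC'⟩ := Finset.exists_injOn_extend
    (Finset.filter_subset (fun c => ∃ a ∈ A, ∃ x ∉ A, x ∉ C ∧ G.Adj x a ∧ G.Adj x c) C)
    (φ := fun c => fA (link c)) (by
      intro c hc c' hc' hcc'
      rw [Finset.mem_coe, Finset.mem_filter] at hc hc'
      obtain ⟨ha, x, hxA, hxC, hxa, hxc⟩ := hlink c hc.2
      obtain ⟨ha', x', hxA', hxC', hxa', hxc'⟩ := hlink c' hc'.2
      have heq : link c = link c' := hfA ha ha' hcc'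
      rw [← heq] at hxa'
      exact h.symm.left_eq_of_common_right h1 hxC hxA hxC' hxA' ha hxa hxa' hc.1 hc'.1 hxc hxc')
    hC
  refine ⟨fun v => if v ∈ A then fA v else fC v, ?_, ?_, ?_⟩
  · intro a ha b hb hab
    rw [Finset.mem_coe] at ha hb
    simp only [ha, hb, if_true] at hab
    exact hfA ha hb hab
  · intro a ha b hb hab
    rw [Finset.mem_coe] at ha hb
    simp only [Finset.disjoint_right.1 h.disjoint ha, Finset.disjoint_right.1 h.disjoint hb,
      if_false] at hab
    exact hfC ha hb hab
  · intro x hxA hxC a ha c hc hxa hxc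
    have hex : ∃ a ∈ A, ∃ x ∉ A, x ∉ C ∧ G.Adj x a ∧ G.Adj x c := ⟨a, ha, x, hxA, hxC, hxa, hxc⟩
    obtain ⟨ha', x', hxA', hxC', hxa', hxc'⟩ := hlink c hex
    simp only [ha, Finset.disjoint_right.1 h.disjoint hc, if_true, if_false]
    rw [hfC' c (Finset.mem_filter.2 ⟨hc, hex⟩)]
    exact congrArg fA
      (h.left_eq_of_common_right h1 hxA' hxC' hxA hxC hc hxc' hxc ha' ha hxa' hxa)

/-- The vertices outside an anticomplete pair whose only neighbours in it are the at most one
vertex of `N` can be coloured while avoiding the colours used on `N`. -/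
theorem exists_class_coloring [Fintype V] (h : G.IsAnticompletePair A C)
    (h1 : IsIndFree P2UP4 G) {α : Type*} [Fintype α] [Nonempty α]
    (hK : ∀ K : Finset V, G.IsClique (K : Set V) → K.card ≤ Fintype.card α)
    {N : Finset V} (hN : N.card ≤ 1) (col : V → α) :
    ∃ g : V → α, ∀ u ∉ N, (∀ z ∈ A, G.Adj u z → z ∈ N) → (∀ z ∈ N, G.Adj u z) →
      (∀ z ∈ N, g u ≠ col z) ∧
      ∀ v ∉ N, (∀ z ∈ A, G.Adj v z → z ∈ N) → (∀ z ∈ N, G.Adj v z) → G.Adj u v → g u ≠ g v := by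
  classical
  obtain ⟨g, hgP, hg⟩ := exists_coloring_of_p4_free (G := G) (Finset.univ \ N.image col)
    (Finset.univ.filter fun u => u ∉ N ∧ (∀ z ∈ A, G.Adj u z → z ∈ N) ∧ ∀ z ∈ N, G.Adj u z)
    (by
      intro a ha b hb c hc d hd hab hbc hcd hac hbd
      simp only [Finset.mem_filter, Finset.mem_univ, true_and] at ha hb hc hd
      by_contra had
      have hcard : 1 < (A \ N).card := by
        have := Finset.le_card_sdiff N A
        have := h.card_left
        omega
      obtain ⟨p, hp, q, hq, hpq⟩ := Finset.one_lt_card.1 hcard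
      rw [Finset.mem_sdiff] at hp hq
      exact not_p2UP4_of_isIndFree h1 (h.isClique_left hp.1 hq.1 hpq) hab hbc hcd hac had hbd
        (fun e => hp.2 (ha.2.1 p hp.1 e.symm)) (fun e => hp.2 (hb.2.1 p hp.1 e.symm))
        (fun e => hp.2 (hc.2.1 p hp.1 e.symm)) (fun e => hp.2 (hd.2.1 p hp.1 e.symm))
        (fun e => hq.2 (ha.2.1 q hq.1 e.symm)) (fun e => hq.2 (hb.2.1 q hq.1 e.symm))
        (fun e => hq.2 (hc.2.1 q hq.1 e.symm)) (fun e => hq.2 (hd.2.1 q hq.1 e.symm)))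
    (by
      intro K hKW hKc
      have hmem : ∀ x ∈ K, x ∉ N ∧ ∀ z ∈ N, G.Adj x z := fun x hx => by
        have := Finset.mem_filter.1 (hKW hx)
        exact ⟨this.2.1, this.2.2.2⟩
      have hclique : G.IsClique ((K ∪ N : Finset V) : Set V) := by
        intro x hx y hy hxy
        rw [Finset.mem_coe, Finset.mem_union] at hx hy
        rcases hx with hx | hx <;> rcases hy with hy | hy
        · exact hKc hx hy hxy
        · exact (hmem x hx).2 y hy
        · exact ((hmem y hy).2 x hx).symm
        · exact absurd (Finset.card_le_one.1 hN x hx y hy) hxy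
      have hle := hK _ hclique
      rw [Finset.card_union_of_disjoint (Finset.disjoint_left.2 fun x hx => (hmem x hx).1)] at hle
      have := Finset.le_card_sdiff (N.image col) Finset.univ
      have : (N.image col).card ≤ N.card := Finset.card_image_le
      rw [Finset.card_univ] at *
      omega)
  simp only [Finset.mem_filter, Finset.mem_univ, true_and, Finset.mem_sdiff, Finset.mem_image,
    not_exists, not_and] at hgP hg
  exact ⟨g, fun u huN huA hu => ⟨fun z hz e => hgP u ⟨huN, huA, hu⟩ z hz e.symm,
    fun v hvN hvA hv huv => hg u ⟨huN, huA, hu⟩ v ⟨hvN, hvA, hv⟩ huv⟩⟩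

theorem colorable [Fintype V] (h : G.IsAnticompletePair A C)
    (h1 : IsIndFree P2UP4 G) (h2 : IsIndFree diamond G)
    (hK : ∀ K : Finset V, G.IsClique (K : Set V) → K.card ≤ A.card) : G.Colorable A.card := by
  classical
  obtain ⟨m, hm⟩ : ∃ m, A.card = m + 3 := ⟨A.card - 3, by have := h.card_left; omega⟩
  rw [hm] at hK ⊢
  have hK' : ∀ K : Finset V, G.IsClique (K : Set V) → K.card ≤ Fintype.card (Fin (m + 3)) := by
    simpa using hK
  obtain ⟨col, hcolA, hcolC, hlink⟩ := h.exists_linked_coloring h1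
    (hK' A h.isClique_left) (hK' C h.isClique_right)
  have hclass : ∀ N : Finset V, ∃ g : V → Fin (m + 3), N.card ≤ 1 →
      ∀ u ∉ N, (∀ z ∈ A, G.Adj u z → z ∈ N) → (∀ z ∈ N, G.Adj u z) → (∀ z ∈ N, g u ≠ col z) ∧
      ∀ v ∉ N, (∀ z ∈ A, G.Adj v z → z ∈ N) → (∀ z ∈ N, G.Adj v z) → G.Adj u v → g u ≠ g v := by
    intro N
    by_cases hN : N.card ≤ 1
    · obtain ⟨g, hg⟩ := h.exists_class_coloring h1 hK' hN col
      exact ⟨g, fun _ => hg⟩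
    · exact ⟨fun _ => 0, fun h => absurd h hN⟩
  choose g hg using hclass
  set N : V → Finset V := fun v => (A ∪ C).filter (G.Adj v) with hNdef
  have hNmem : ∀ v z, z ∈ N v ↔ z ∈ A ∪ C ∧ G.Adj v z := fun v z => Finset.mem_filter
  have hself : ∀ v w, v ∉ A → v ∉ C → v ∉ N w := fun v w hA hC hv =>
    (Finset.mem_union.1 ((hNmem w v).1 hv).1).elim hA hC
  have hNA : ∀ v, ∀ z ∈ A, G.Adj v z → z ∈ N v := fun v z hz hvz =>
    (hNmem v z).2 ⟨Finset.mem_union_left _ hz, hvz⟩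
  have hNadj : ∀ v, ∀ z ∈ N v, G.Adj v z := fun v z hz => ((hNmem v z).1 hz).2
  let B : V → Prop := fun v => ∃ a ∈ A, ∃ c ∈ C, G.Adj v a ∧ G.Adj v c
  have hNcard : ∀ v, v ∉ A → v ∉ C → ¬ B v → (N v).card ≤ 1 := by
    intro v hvA hvC hB
    rw [Finset.card_le_one]
    intro x hx y hy
    rw [hNmem, Finset.mem_union] at hx hy
    obtain ⟨hx | hx, hvx⟩ := hx <;> obtain ⟨hy | hy, hvy⟩ := hy
    · exact h.eq_left v hvA x hx y hy hvx hvy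
    · exact absurd ⟨x, hx, y, hy, hvx, hvy⟩ hB
    · exact absurd ⟨y, hy, x, hx, hvy, hvx⟩ hB
    · exact h.eq_right v hvC x hx y hy hvx hvy
  have hα : ∀ v, ∃ a, B v → a ∈ A ∧ ∃ c ∈ C, G.Adj v a ∧ G.Adj v c := by
    intro v
    by_cases hB : B v
    · obtain ⟨a, ha⟩ := hB
      exact ⟨a, fun _ => ha⟩
    · exact ⟨v, fun h => absurd h hB⟩
  choose α hα using hα
  let f : V → Fin (m + 3) := fun v => if v ∈ A ∪ C then col v else
    if B v then col (α v) + 1 else g (N v) v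
  have hf_in : ∀ v ∈ A ∪ C, f v = col v := fun v hv => if_pos hv
  have hf_both : ∀ v, v ∉ A → v ∉ C → B v → f v = col (α v) + 1 := fun v hA hC hB => by
    simp only [f, Finset.mem_union, hA, hC, or_self, if_false, hB, if_true]
  have hf_class : ∀ v, v ∉ A → v ∉ C → ¬ B v → f v = g (N v) v := fun v hA hC hB => by
    simp only [f, Finset.mem_union, hA, hC, or_self, if_false, hB]
  have hout : ∀ u z, u ∉ A → u ∉ C → z ∈ A ∪ C → G.Adj u z → f u ≠ f z := by
    intro u z huA huC hz huz
    rw [hf_in z hz]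
    by_cases hB : B u
    · obtain ⟨ha, c, hc, hua, huc⟩ := hα u hB
      have hcol : col z = col (α u) := by
        rcases Finset.mem_union.1 hz with hz | hz
        · rw [h.eq_left u huA z hz _ ha huz hua]
        · exact hlink u huA huC _ ha z hz hua huz
      rw [hf_both u huA huC hB, hcol]
      simp
    · rw [hf_class u huA huC hB]
      exact (hg (N u) (hNcard u huA huC hB) u (hself u u huA huC) (hNA u) (hNadj u)).1 z
        ((hNmem u z).2 ⟨hz, huz⟩)
  refine ⟨Coloring.mk f fun {u v} huv => ?_⟩
  by_cases hu : u ∈ A ∪ C <;> by_cases hv : v ∈ A ∪ C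
  · rw [hf_in u hu, hf_in v hv]
    rcases Finset.mem_union.1 hu with hu | hu <;> rcases Finset.mem_union.1 hv with hv | hv
    · exact fun e => huv.ne (hcolA hu hv e)
    · exact absurd huv (h.anti u hu v hv)
    · exact absurd huv.symm (h.anti v hv u hu)
    · exact fun e => huv.ne (hcolC hu hv e)
  · rw [Finset.mem_union, not_or] at hv
    exact (hout v u hv.1 hv.2 hu huv.symm).symm
  · rw [Finset.mem_union, not_or] at hu
    exact hout u v hu.1 hu.2 hv huv
  · rw [Finset.mem_union, not_or] at hu hv
    have hboth : B u → B v → f u ≠ f v := by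
      intro hBu hBv e
      rw [hf_both u hu.1 hu.2 hBu, hf_both v hv.1 hv.2 hBv, add_left_inj] at e
      obtain ⟨ha, c, hc, hua, huc⟩ := hα u hBu
      obtain ⟨ha', c', hc', hva, hvc⟩ := hα v hBv
      rw [← hcolA ha ha' e] at hva
      have hcc' := h.symm.left_eq_of_common_right h1 hu.2 hu.1 hv.2 hv.1 ha hua hva hc hc' huc hvc
      rw [← hcc'] at hvc
      exact h.not_adj_of_common_left_right h2 ha hc hua hva huc hvc huv
    rcases h.filter_adj_eq_or h1 hu.1 hu.2 hv.1 hv.2 huv with ⟨hA, hC⟩ | ⟨hBu, hBv⟩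
    · have hNuv : N u = N v := by simp only [hNdef, Finset.filter_union, hA, hC]
      have hadj : ∀ z ∈ A ∪ C, G.Adj u z ↔ G.Adj v z := fun z hz => by
        have := Finset.ext_iff.1 hNuv z
        rw [hNmem, hNmem] at this
        simpa [hz] using this
      have hBB : B u ↔ B v := by
        refine exists_congr fun a => and_congr_right fun ha => exists_congr fun c =>
          and_congr_right fun hc => ?_
        rw [hadj a (Finset.mem_union_left _ ha), hadj c (Finset.mem_union_right _ hc)]
      by_cases hB : B u
      · exact hboth hB (hBB.1 hB)
      · have hBv : ¬ B v := fun e => hB (hBB.2 e)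
        rw [hf_class u hu.1 hu.2 hB, hf_class v hv.1 hv.2 hBv, ← hNuv]
        exact (hg (N u) (hNcard u hu.1 hu.2 hB) u (hself u u hu.1 hu.2) (hNA u) (hNadj u)).2 v
          (hself v u hv.1 hv.2) (hNuv ▸ hNA v) (hNuv ▸ hNadj v) huv
    · exact hboth hBu hBv

end IsAnticompletePair

/-- In a diamond-free graph, a vertex that does not extend a clique has at most one neighbour
in it. -/
theorem eq_of_adj_of_adj_isClique (h2 : IsIndFree diamond G) {K : Finset V}
    (hK : G.IsClique (K : Set V)) {v a b : V} (hv : ∃ x ∈ K, x ≠ v ∧ ¬ G.Adj v x)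
    (ha : a ∈ K) (hb : b ∈ K) (hva : G.Adj v a) (hvb : G.Adj v b) : a = b := by
  by_contra hab
  obtain ⟨x, hx, hxv, hvx⟩ := hv
  have hxa : x ≠ a := by
    rintro rfl
    exact hvx hva
  have hxb : x ≠ b := by
    rintro rfl
    exact hvx hvb
  exact hvx (adj_of_diamond_isIndFree h2 hxv.symm (hK ha hb hab) hva hvb (hK hx ha hxa)
    (hK hx hb hxb))

end SimpleGraph

theorem chi_eq_omega_of_anticomplete_Kk {V : Type*} [Fintype V] [DecidableEq V]
    (G : SimpleGraph V)
    (h1 : IsIndFree P2UP4 G) (h2 : IsIndFree diamond G) (hw : 3 ≤ G.cliqueNum)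
    (A : Finset V) (hA : G.IsClique (A : Set V)) (hAmax : A.card = G.cliqueNum)
    (hk : 3 ≤ (G.induce ((A : Set V)ᶜ)).cliqueNum)
    (C : Finset V) (hAC : Disjoint A C) (hC : G.IsClique (C : Set V))
    (hCcard : C.card = (G.induce ((A : Set V)ᶜ)).cliqueNum)
    (hanti : ∀ c ∈ C, ∀ a ∈ A, ¬ G.Adj c a) :
    G.chromaticNumber = (G.cliqueNum : ℕ∞) := by
  have hcliq : ∀ K : Finset V, G.IsClique (K : Set V) → K.card ≤ A.card := fun K hK => by
    rw [hAmax]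
    exact hK.card_le_cliqueNum
  have hcliqH : ∀ K : Finset V, Disjoint A K → G.IsClique (K : Set V) → K.card ≤ C.card := by
    intro K hAK hK
    have hcard : (K.subtype (· ∈ (A : Set V)ᶜ)).card = K.card := by
      rw [Finset.card_subtype, Finset.filter_true_of_mem]
      exact fun x hx hxA => Finset.disjoint_left.1 hAK hxA hx
    rw [hCcard, ← hcard]
    refine IsClique.card_le_cliqueNum (tc := fun x hx y hy hxy =>
      hK (Finset.mem_subtype.1 hx) (Finset.mem_subtype.1 hy) fun e => hxy (Subtype.ext e))
  have hpair : G.IsAnticompletePair A C :=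
    { isClique_left := hA
      isClique_right := hC
      disjoint := hAC
      card_left := hAmax ▸ hw
      card_right := hCcard ▸ hk
      anti := fun a ha c hc h => hanti c hc a ha h.symm
      eq_left := by
        intro v hv a ha b hb
        refine eq_of_adj_of_adj_isClique h2 hA ?_ ha hb
        by_contra! hcon
        have := hcliq (insert v A) (by
          rw [Finset.coe_insert]
          exact hA.insert fun x hx hne => hcon x hx hne.symm)
        rw [Finset.card_insert_of_notMem hv] at this
        omega
      eq_right := by
        intro v hv a ha b hb hva hvb
        by_cases hvA : v ∈ A
        · exact absurd hva.symm (hanti a ha v hvA)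
        refine eq_of_adj_of_adj_isClique h2 hC ?_ ha hb hva hvb
        by_contra! hcon
        have := hcliqH (insert v C) (Finset.disjoint_insert_right.2 ⟨hvA, hAC⟩) (by
          rw [Finset.coe_insert]
          exact hC.insert fun x hx hne => hcon x hx hne.symm)
        rw [Finset.card_insert_of_notMem hv] at this
        omega }
  rw [← hAmax]
  exact le_antisymm (hpair.colorable h1 h2 hcliq).chromaticNumber_le hA.card_le_chromaticNumber
end

section
/- Let G be a finite simple (P2 ∪ P4, diamond)-free graph with ω(G) = 3, let A be a maximum clique of G, and suppose the clique number of G − A equals 3. Then χ(G) ≤ 6. -/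
open SimpleGraph

/-- `G` has no induced path on four vertices. -/
def NoInducedP4 {W : Type*} (G : SimpleGraph W) : Prop :=
  ∀ a b c d, G.Adj a b → G.Adj b c → G.Adj c d → ¬G.Adj a c → ¬G.Adj b d → ¬G.Adj a d → False

/-- Every edge of `G` lies in at most one triangle. -/
def EdgeInOneTriangle {W : Type*} (G : SimpleGraph W) : Prop :=
  ∀ a b c d, G.Adj c d → G.Adj a c → G.Adj a d → G.Adj b c → G.Adj b d → a = b

section P4Free

variable {W : Type*} {G : SimpleGraph W}

lemma NoInducedP4.induce (h : NoInducedP4 G) (S : Set W) : NoInducedP4 (G.induce S) :=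
  fun a b c d => h a b c d

lemma EdgeInOneTriangle.induce (h : EdgeInOneTriangle G) (S : Set W) :
    EdgeInOneTriangle (G.induce S) :=
  fun a b c d h1 h2 h3 h4 h5 => Subtype.ext (h a b c d h1 h2 h3 h4 h5)

lemma mem_of_reachable {S : Set W} (hS : ∀ x ∈ S, ∀ y, G.Adj x y → y ∈ S) {u v : W}
    (huv : G.Reachable u v) (hu : u ∈ S) : v ∈ S := by
  obtain ⟨p⟩ := huv
  induction p with
  | nil => exact hu
  | cons h _ ih => exact ih (hS _ hu _ h)

/-- In a graph without an induced `P4`, vertices in one component are at distance at most two. -/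
lemma NoInducedP4.eq_or_adj_or_exists (h : NoInducedP4 G) {u v : W} (huv : G.Reachable u v) :
    u = v ∨ G.Adj u v ∨ ∃ x, G.Adj u x ∧ G.Adj x v := by
  refine mem_of_reachable (S := {v | u = v ∨ G.Adj u v ∨ ∃ x, G.Adj u x ∧ G.Adj x v})
    ?_ huv (Or.inl rfl)
  rintro x (rfl | hx | ⟨w, huw, hwx⟩) y hxy
  · exact Or.inr (Or.inl hxy)
  · exact Or.inr (Or.inr ⟨x, hx, hxy⟩)
  · by_contra hc
    simp only [Set.mem_ofPred_eq, not_or, not_exists, not_and] at hc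
    exact h u w x y huw hwx hxy (fun hux => hc.2.2 x hux hxy) (hc.2.2 w huw) hc.2.1

lemma NoInducedP4.colorable_two (h : NoInducedP4 G)
    (ht : ∀ a b c, G.Adj a b → G.Adj b c → G.Adj a c → False) : G.Colorable 2 := by
  classical
  let root : W → W := fun v => (G.connectedComponentMk v).out
  have hroot : ∀ v, G.Reachable (root v) v := fun v =>
    ConnectedComponent.exact (Quot.out_eq (G.connectedComponentMk v))
  let C : G.Coloring Bool := Coloring.mk (fun v => decide (G.Adj (root v) v)) (by
    intro u v huv heq
    have hr : root u = root v :=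
      congrArg Quot.out (ConnectedComponent.sound huv.reachable)
    have hu := h.eq_or_adj_or_exists (hroot u)
    simp only [decide_eq_decide] at heq
    rw [hr] at heq hu
    rcases hu with hu | hu | ⟨x, hx, hxu⟩
    · rw [← hu] at heq huv
      exact G.loopless.irrefl _ (heq.mpr huv)
    · exact ht _ _ _ hu huv (heq.mp hu)
    · by_cases hru : G.Adj (root v) u
      · exact ht _ _ _ hru huv (heq.mp hru)
      · exact h _ _ _ _ hx hxu huv hru (fun hxv => ht _ _ _ hxu huv hxv) (fun k => hru (heq.mpr k)))
  simpa using C.colorable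

/-- If a vertex `p` of a triangle has a neighbour outside the triangle, then no vertex is at
distance two from `p`. -/
lemma adj_or_eq_of_triangle (h : NoInducedP4 G) (hd : EdgeInOneTriangle G) {p q r v x y : W}
    (hpq : G.Adj p q) (hqr : G.Adj q r) (hpr : G.Adj p r) (hpv : G.Adj p v)
    (hvq : v ≠ q) (hvr : v ≠ r) (hpx : p = x ∨ G.Adj p x) (hxy : G.Adj x y) :
    p = y ∨ G.Adj p y := by
  rcases hpx with rfl | hpx
  · exact Or.inr hxy
  by_contra! hc
  obtain ⟨hne, hpy⟩ := hc
  -- `y` has no neighbour on the triangle; this covers `x` lying on it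
  have key : ∀ q r, G.Adj p q → G.Adj q r → G.Adj p r → v ≠ q → v ≠ r → ¬G.Adj q y := by
    intro q r hpq hqr hpr hvq hvr hqy
    have hqv : ¬G.Adj q v := fun k => hvr (hd _ _ _ _ hpq hpv.symm k.symm hpr.symm hqr.symm)
    have hrv : ¬G.Adj r v := fun k => hvq (hd _ _ _ _ hpr hpv.symm k.symm hpq.symm hqr)
    have hry : ¬G.Adj r y := fun k => hne (hd _ _ _ _ hqr hpq hpr hqy.symm k.symm)
    by_cases hyv : G.Adj y v
    · exact h r q y v hqr.symm hqy hyv hry hqv hrv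
    · exact h y q p v hqy.symm hpq.symm hpv (fun k => hpy k.symm) hqv hyv
  have hqy := key q r hpq hqr hpr hvq hvr
  have hry := key r q hpr hqr.symm hpq hvr hvq
  have hxq : x ≠ q := by rintro rfl; exact hqy hxy
  have hxr : x ≠ r := by rintro rfl; exact hry hxy
  have hqx : ¬G.Adj q x := fun k => hxr (hd _ _ _ _ hpq hpx.symm k.symm hpr.symm hqr.symm)
  exact h q p x y hpq.symm hpx hxy hqx hpy hqy

lemma exists_center_of_triangle (h : NoInducedP4 G) (hd : EdgeInOneTriangle G) {p q r : W}
    (hpq : G.Adj p q) (hqr : G.Adj q r) (hpr : G.Adj p r) :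
    ∃ c, G.Reachable p c ∧ ∀ v, G.Reachable c v → c = v ∨ G.Adj c v := by
  have key : ∀ p q r, G.Adj p q → G.Adj q r → G.Adj p r →
      (∃ v, G.Adj p v ∧ v ≠ q ∧ v ≠ r) → ∀ v, G.Reachable p v → p = v ∨ G.Adj p v := by
    rintro p q r hpq hqr hpr ⟨v, hpv, hvq, hvr⟩ w hw
    exact mem_of_reachable (S := {w | p = w ∨ G.Adj p w})
      (fun x hx y hxy => adj_or_eq_of_triangle h hd hpq hqr hpr hpv hvq hvr hx hxy) hw
      (Or.inl rfl)
  by_cases hp : ∃ v, G.Adj p v ∧ v ≠ q ∧ v ≠ r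
  · exact ⟨p, .rfl, key p q r hpq hqr hpr hp⟩
  by_cases hq : ∃ v, G.Adj q v ∧ v ≠ p ∧ v ≠ r
  · exact ⟨q, hpq.reachable, key q p r hpq.symm hpr hqr hq⟩
  by_cases hr : ∃ v, G.Adj r v ∧ v ≠ p ∧ v ≠ q
  · exact ⟨r, hpr.reachable, key r p q hpr.symm hpq hqr.symm hr⟩
  refine ⟨p, .rfl, fun w hw => ?_⟩
  refine mem_of_reachable (S := {w | p = w ∨ G.Adj p w}) ?_ hw (Or.inl rfl)
  rintro x hx y hxy
  have hx' : x = p ∨ x = q ∨ x = r := by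
    rcases hx with rfl | hx
    · exact Or.inl rfl
    · by_contra! hc
      exact hp ⟨x, hx, hc.2⟩
  simp only [Set.mem_ofPred_eq]
  push Not at hp hq hr
  grind

lemma colorable_union {S T : Set W} {m n : ℕ} (hS : (G.induce S).Colorable m)
    (hT : (G.induce T).Colorable n) : (G.induce (S ∪ T)).Colorable (m + n) := by
  classical
  obtain ⟨f⟩ := hS
  obtain ⟨g⟩ := hT
  let C : (G.induce (S ∪ T)).Coloring (Fin m ⊕ Fin n) := Coloring.mk
    (fun v => if hv : v.1 ∈ S then Sum.inl (f ⟨v.1, hv⟩)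
      else Sum.inr (g ⟨v.1, v.2.resolve_left hv⟩)) (by
    intro u v huv
    by_cases hu : u.1 ∈ S <;> by_cases hv : v.1 ∈ S <;> simp only [hu, hv, dite_true, dite_false,
      ne_eq, Sum.inl.injEq, Sum.inr.injEq, reduceCtorEq, not_false_eq_true]
    · exact f.valid (v := ⟨u.1, hu⟩) (w := ⟨v.1, hv⟩) huv
    · exact g.valid (v := ⟨u.1, u.2.resolve_left hu⟩) (w := ⟨v.1, v.2.resolve_left hv⟩) huv)
  simpa using C.colorable

lemma colorable_one_of_isIndepSet {S : Set W} (hS : G.IsIndepSet S) :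
    (G.induce S).Colorable 1 :=
  ⟨Coloring.mk (fun _ => 0) fun {u v} huv => (hS u.2 v.2 (fun h => huv.ne (Subtype.ext h)) huv).elim⟩

lemma colorable_insert {S : Set W} {n : ℕ} (hn : 1 ≤ n) (hS : (G.induce S).Colorable n) {a : W}
    (ha : ∀ v ∈ S, ¬G.Adj a v) : (G.induce (insert a S)).Colorable n := by
  classical
  obtain ⟨f⟩ := hS
  refine ⟨Coloring.mk (fun v => if hv : v.1 ∈ S then f ⟨v.1, hv⟩ else ⟨0, hn⟩) ?_⟩
  intro u v huv
  have huv' : G.Adj u.1 v.1 := huv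
  by_cases hu : u.1 ∈ S <;> by_cases hv : v.1 ∈ S
  · simpa only [hu, hv, dite_true] using f.valid (v := ⟨u.1, hu⟩) (w := ⟨v.1, hv⟩) huv
  · rw [v.2.resolve_right hv] at huv'
    exact (ha _ hu huv'.symm).elim
  · rw [u.2.resolve_right hu] at huv'
    exact (ha _ hv huv').elim
  · exact (huv'.ne ((u.2.resolve_right hu).trans (v.2.resolve_right hv).symm)).elim

lemma NoInducedP4.colorable_three (h : NoInducedP4 G) (hd : EdgeInOneTriangle G) :
    G.Colorable 3 := by
  classical
  have hcenter : ∀ K : G.ConnectedComponent, ∃ c, G.connectedComponentMk c = K ∧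
      ∀ p q r, G.Adj p q → G.Adj q r → G.Adj p r → G.connectedComponentMk p = K →
        ∀ v, G.connectedComponentMk v = K → c = v ∨ G.Adj c v := by
    intro K
    by_cases hK : ∃ p q r, G.Adj p q ∧ G.Adj q r ∧ G.Adj p r ∧ G.connectedComponentMk p = K
    · obtain ⟨p, q, r, hpq, hqr, hpr, rfl⟩ := hK
      obtain ⟨c, hpc, hc⟩ := exists_center_of_triangle h hd hpq hqr hpr
      exact ⟨c, ConnectedComponent.sound hpc.symm, fun _ _ _ _ _ _ _ v hv =>
        hc v (hpc.symm.trans (ConnectedComponent.exact hv).symm)⟩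
    · obtain ⟨c, hc⟩ := K.exists_rep
      exact ⟨c, hc, fun p q r h1 h2 h3 h4 => (hK ⟨p, q, r, h1, h2, h3, h4⟩).elim⟩
  choose c hcK hc using hcenter
  have h1 : (G.induce (Set.range c)).Colorable 1 := by
    refine colorable_one_of_isIndepSet ?_
    rintro _ ⟨K, rfl⟩ _ ⟨L, rfl⟩ hne hadj
    have := ConnectedComponent.sound hadj.reachable
    rw [hcK, hcK] at this
    exact hne (this ▸ rfl)
  have h2 : (G.induce (Set.range c)ᶜ).Colorable 2 := by
    refine (h.induce _).colorable_two ?_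
    rintro ⟨p, hp⟩ ⟨q, hq⟩ ⟨r, hr⟩ hpq hqr hpr
    simp only [comap_adj, Function.Embedding.subtype_apply] at hpq hqr hpr
    have hcp := hc _ p q r hpq hqr hpr rfl
    have hp' := (hcp p rfl).resolve_left (fun k => hp ⟨_, k⟩)
    have hq' := (hcp q (ConnectedComponent.sound hpq.reachable.symm)).resolve_left
      (fun k => hq ⟨_, k⟩)
    exact hr ⟨_, hd _ _ p q hpq hp' hq' hpr.symm hqr.symm⟩
  have h3 := colorable_union h1 h2
  rw [Set.union_compl_self] at h3
  exact h3.of_hom (G.induceUnivIso.symm.toHom)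

end P4Free

section Forbidden

variable {V : Type*} {G : SimpleGraph V}

lemma edgeInOneTriangle_of_isIndFree_diamond (h : IsIndFree diamond G) (h4 : G.CliqueFree 4) :
    EdgeInOneTriangle G := by
  classical
  intro a b c d hcd hac had hbc hbd
  by_contra hab
  by_cases hadj : G.Adj a b
  · have := hadj.ne; have := hcd.ne; have := hac.ne; have := had.ne; have := hbc.ne
    have := hbd.ne
    refine h4 {a, b, c, d} ⟨?_, Finset.card_eq_four.mpr ⟨a, b, c, d, by simp [*]⟩⟩
    simp [isClique_insert, *]
  · refine h.elim ⟨⟨![a, b, c, d], ?_⟩, ?_⟩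
    · intro i j
      have := hcd.ne; have := hac.ne; have := had.ne; have := hbc.ne; have := hbd.ne
      fin_cases i <;> fin_cases j <;> simp <;> grind
    · intro i j
      have := hcd.symm; have := hac.symm; have := had.symm; have := hbc.symm; have := hbd.symm
      have : ¬G.Adj b a := fun k => hadj k.symm
      change G.Adj (![a, b, c, d] i) (![a, b, c, d] j) ↔ _
      fin_cases i <;> fin_cases j <;> simp [diamond, *]

lemma noInducedP4_anticomplete_edge (h : IsIndFree P2UP4 G) {p q a b c d : V} (hpq : G.Adj p q)
    (hab : G.Adj a b) (hbc : G.Adj b c) (hcd : G.Adj c d)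
    (hac : ¬G.Adj a c) (hbd : ¬G.Adj b d) (had : ¬G.Adj a d)
    (hp : ¬G.Adj p a ∧ ¬G.Adj p b ∧ ¬G.Adj p c ∧ ¬G.Adj p d)
    (hq : ¬G.Adj q a ∧ ¬G.Adj q b ∧ ¬G.Adj q c ∧ ¬G.Adj q d) : False := by
  refine h.elim ⟨⟨![p, q, a, b, c, d], ?_⟩, ?_⟩
  · intro i j
    have h1 := hpq.symm; have h2 := hab.symm; have h3 := hbc.symm; have h4 := hcd.symm
    have := hpq.ne; have := hab.ne; have := hbc.ne; have := hcd.ne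
    fin_cases i <;> fin_cases j <;> simp <;> grind
  · intro i j
    obtain ⟨hp1, hp2, hp3, hp4⟩ := hp
    obtain ⟨hq1, hq2, hq3, hq4⟩ := hq
    have hs : ∀ {u v}, ¬G.Adj u v → ¬G.Adj v u := fun k l => k l.symm
    have := hs hac; have := hs hbd; have := hs had; have := hs hp1
    have := hs hp2; have := hs hp3; have := hs hp4; have := hs hq1
    have := hs hq2; have := hs hq3; have := hs hq4
    clear hs
    have := hpq.symm; have := hab.symm; have := hbc.symm; have := hcd.symm
    change G.Adj (![p, q, a, b, c, d] i) (![p, q, a, b, c, d] j) ↔ _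
    fin_cases i <;> fin_cases j <;> simp [P2UP4, *]

end Forbidden

section Sectors

variable {V : Type*} {G : SimpleGraph V} {a : Fin 3 → V}

/-- The vertices whose only possible neighbour among `a 0`, `a 1`, `a 2` is `a i`. -/
def sector (G : SimpleGraph V) (a : Fin 3 → V) (i : Fin 3) : Set V :=
  {v | ∀ j, j ≠ i → ¬G.Adj (a j) v}

/-- The vertices of `sector G a i` that are adjacent to `a i` or lie in no triangle inside
`sector G a i`. -/
def triangleFreePart (G : SimpleGraph V) (a : Fin 3 → V) (i : Fin 3) : Set V :=
  {v | v ∈ sector G a i ∧ (G.Adj (a i) v ∨ ¬∃ q ∈ sector G a i, ∃ r ∈ sector G a i,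
    G.Adj v q ∧ G.Adj q r ∧ G.Adj v r)}

lemma noInducedP4_sector (h : IsIndFree P2UP4 G) (ha : ∀ i j, i ≠ j → G.Adj (a i) (a j))
    (i : Fin 3) : NoInducedP4 (G.induce (sector G a i)) := by
  rintro ⟨u, hu⟩ ⟨v, hv⟩ ⟨w, hw⟩ ⟨x, hx⟩ h1 h2 h3 h4 h5 h6
  have e1 : i + 1 ≠ i := by fin_cases i <;> decide
  have e2 : i + 2 ≠ i := by fin_cases i <;> decide
  have e3 : i + 1 ≠ i + 2 := by fin_cases i <;> decide
  exact noInducedP4_anticomplete_edge h (ha _ _ e3) h1 h2 h3 h4 h5 h6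
    ⟨hu _ e1, hv _ e1, hw _ e1, hx _ e1⟩ ⟨hu _ e2, hv _ e2, hw _ e2, hx _ e2⟩

lemma exists_mem_sector (hd : EdgeInOneTriangle G) (ha : ∀ i j, i ≠ j → G.Adj (a i) (a j))
    {v : V} (hv : ∀ i, v ≠ a i) : ∃ i, v ∈ sector G a i := by
  by_contra! hc
  simp only [sector, Set.mem_ofPred_eq, not_forall, not_not] at hc
  obtain ⟨j, -, hj⟩ := hc 0
  obtain ⟨k, hkj, hk⟩ := hc j
  obtain ⟨l, hlj, hlk⟩ : ∃ l, l ≠ j ∧ l ≠ k := by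
    clear hk hj
    revert j k
    decide
  exact hv l (hd _ _ _ _ (ha k j hkj) hk.symm hj.symm (ha l k hlk) (ha l j hlj))

lemma colorable_of_cover_sectors (hd : EdgeInOneTriangle G)
    (ha : ∀ i j, i ≠ j → G.Adj (a i) (a j)) (i : Fin 3) {S T U : Set V} {l m n : ℕ}
    (hl : 1 ≤ l) (hm : 1 ≤ m) (hn : 1 ≤ n)
    (hS : (G.induce S).Colorable l) (hT : (G.induce T).Colorable m)
    (hU : (G.induce U).Colorable n)
    (hSi : S ⊆ sector G a i) (hTi : T ⊆ sector G a (i + 1)) (hUi : U ⊆ sector G a (i + 2))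
    (hcover : ∀ j, sector G a j ⊆ S ∪ T ∪ U) : G.Colorable (l + m + n) := by
  have h1 := colorable_insert hl hS (a := a (i + 1))
    (fun v hv => hSi hv _ (by fin_cases i <;> decide))
  have h2 := colorable_insert hm hT (a := a (i + 2))
    (fun v hv => hTi hv _ (by fin_cases i <;> decide))
  have h3 := colorable_insert hn hU (a := a i)
    (fun v hv => hUi hv _ (by fin_cases i <;> decide))
  have h4 := colorable_union (colorable_union h1 h2) h3
  have huniv : insert (a (i + 1)) S ∪ insert (a (i + 2)) T ∪ insert (a i) U = Set.univ := by
    refine Set.eq_univ_of_forall fun v => ?_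
    by_cases hv : ∀ j, v ≠ a j
    · obtain ⟨j, hj⟩ := exists_mem_sector hd ha hv
      have := hcover j hj
      simp only [Set.mem_union, Set.mem_insert_iff] at this ⊢
      tauto
    · push Not at hv
      obtain ⟨j, rfl⟩ := hv
      have : j = i ∨ j = i + 1 ∨ j = i + 2 := by clear * -; revert i j; decide
      simp only [Set.mem_union, Set.mem_insert_iff]
      rcases this with rfl | rfl | rfl <;> simp
  rw [huniv] at h4
  exact h4.of_hom G.induceUnivIso.symm.toHom

lemma colorable_two_triangleFreePart (h : IsIndFree P2UP4 G) (hd : EdgeInOneTriangle G)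
    (ha : ∀ i j, i ≠ j → G.Adj (a i) (a j)) (i : Fin 3) :
    (G.induce (triangleFreePart G a i)).Colorable 2 := by
  refine NoInducedP4.colorable_two (fun u v w x => noInducedP4_sector h ha i
    ⟨u.1, u.2.1⟩ ⟨v.1, v.2.1⟩ ⟨w.1, w.2.1⟩ ⟨x.1, x.2.1⟩) ?_
  rintro ⟨p, hp, hp'⟩ ⟨q, hq, hq'⟩ ⟨r, hr, hr'⟩ (hpq : G.Adj p q) (hqr : G.Adj q r)
    (hpr : G.Adj p r)
  have hp'' := hp'.resolve_right (not_not.mpr ⟨q, hq, r, hr, hpq, hqr, hpr⟩)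
  have hq'' := hq'.resolve_right (not_not.mpr ⟨p, hp, r, hr, hpq.symm, hpr, hqr⟩)
  have hr'' := hr'.resolve_right (not_not.mpr ⟨p, hp, q, hq, hpr.symm, hpq, hqr.symm⟩)
  exact hr''.ne (hd _ _ _ _ hpq hp'' hq'' hpr.symm hqr.symm)

/-- If a vertex `z` without neighbours in the triangle `a` is in a triangle inside a sector and has
a further neighbour there, then `z` has no neighbour on an edge inside the neighbourhood of `a i`. -/
lemma not_adj_of_triangle (h : IsIndFree P2UP4 G) (hd : EdgeInOneTriangle G)
    (ha : ∀ i j, i ≠ j → G.Adj (a i) (a j)) {i : Fin 3} {z q r v x y : V}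
    (hz : ∀ j, ¬G.Adj (a j) z) (hq : q ∈ sector G a i) (hr : r ∈ sector G a i)
    (hv : v ∈ sector G a i) (hzq : G.Adj z q) (hqr : G.Adj q r) (hzr : G.Adj z r)
    (hzv : G.Adj z v) (hvq : v ≠ q) (hvr : v ≠ r)
    (hx : x ∈ sector G a i) (hax : G.Adj (a i) x) (hy : y ∈ sector G a i) (hay : G.Adj (a i) y)
    (hxy : G.Adj x y) : ¬G.Adj z x ∧ ∀ w ∈ sector G a i, G.Adj z w → ¬G.Adj w x := by
  have hzs : z ∈ sector G a i := fun j _ => hz j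
  have key : ∀ {s t}, s ∈ sector G a i → t ∈ sector G a i → G.Adj z s → G.Adj s t →
      z = t ∨ G.Adj z t := by
    intro s t hs ht hzs' hst
    have := adj_or_eq_of_triangle (noInducedP4_sector h ha i) (hd.induce _)
      (p := ⟨z, hzs⟩) (q := ⟨q, hq⟩) (r := ⟨r, hr⟩) (v := ⟨v, hv⟩) (x := ⟨s, hs⟩) (y := ⟨t, ht⟩)
      hzq hqr hzr hzv (fun k => hvq (congrArg Subtype.val k))
      (fun k => hvr (congrArg Subtype.val k)) (Or.inr hzs') hst
    exact this.imp (congrArg Subtype.val) id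
  have hzx : ¬G.Adj z x := by
    intro hzx
    rcases key hx hy hzx hxy with rfl | hzy
    · exact hz i hay
    · obtain rfl := hd _ _ _ _ hxy hzx hzy hax hay
      exact hz (i + 1) (ha _ _ (by fin_cases i <;> decide))
  refine ⟨hzx, fun w hw hzw hwx => ?_⟩
  rcases key hw hx hzw hwx with rfl | k
  · exact hz i hax
  · exact hzx k

lemma not_anticomplete_edge (h : IsIndFree P2UP4 G) (hd : EdgeInOneTriangle G)
    (ha : ∀ i j, i ≠ j → G.Adj (a i) (a j)) {x y : Fin 3 → V}
    (hx : ∀ i, x i ∈ sector G a i) (hax : ∀ i, G.Adj (a i) (x i))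
    (hy : ∀ i, y i ∈ sector G a i) (hay : ∀ i, G.Adj (a i) (y i))
    (hxy : ∀ i, G.Adj (x i) (y i)) {z w : V} (hzw : G.Adj z w)
    (hz : ∀ j, ¬G.Adj (a j) z) (hw : ∀ j, ¬G.Adj (a j) w)
    (hzx : ∀ i, ¬G.Adj z (x i)) (hzy : ∀ i, ¬G.Adj z (y i))
    (hwx : ∀ i, ¬G.Adj w (x i)) (hwy : ∀ i, ¬G.Adj w (y i)) : False := by
  have key : ∀ t, t ∈ sector G a 1 → G.Adj (a 1) t → ¬G.Adj z t → ¬G.Adj w t →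
      G.Adj (x 0) t := by
    intro t ht hat hzt hwt
    by_contra hxt
    exact noInducedP4_anticomplete_edge h hzw (hax 0).symm (ha 0 1 (by decide)) hat
      (fun k => hx 0 1 (by decide) k.symm) (ht 0 (by decide)) hxt
      ⟨hzx 0, fun k => hz 0 k.symm, fun k => hz 1 k.symm, hzt⟩
      ⟨hwx 0, fun k => hw 0 k.symm, fun k => hw 1 k.symm, hwt⟩
  have hxa := hd _ _ _ _ (hxy 1) (key _ (hx 1) (hax 1) (hzx 1) (hwx 1))
    (key _ (hy 1) (hay 1) (hzy 1) (hwy 1)) (hax 1) (hay 1)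
  exact hx 0 2 (by decide) (hxa ▸ ha 2 1 (by decide))

lemma exists_mem_triangleFreePart (h : IsIndFree P2UP4 G) (hd : EdgeInOneTriangle G)
    (ha : ∀ i j, i ≠ j → G.Adj (a i) (a j)) {x y : Fin 3 → V}
    (hx : ∀ i, x i ∈ sector G a i) (hax : ∀ i, G.Adj (a i) (x i))
    (hy : ∀ i, y i ∈ sector G a i) (hay : ∀ i, G.Adj (a i) (y i))
    (hxy : ∀ i, G.Adj (x i) (y i)) {z : V} (hz : ∀ j, ¬G.Adj (a j) z) :
    ∃ i, z ∈ triangleFreePart G a i := by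
  by_contra! hc
  have htri : ∀ i, ∃ q r, (∀ j, ¬G.Adj (a j) q) ∧ r ∈ sector G a i ∧
      G.Adj z q ∧ G.Adj q r ∧ G.Adj z r := by
    intro i
    have : ∃ q ∈ sector G a i, ∃ r ∈ sector G a i, G.Adj z q ∧ G.Adj q r ∧ G.Adj z r := by
      by_contra k
      exact hc i ⟨fun j _ => hz j, Or.inr k⟩
    obtain ⟨q, hq, r, hr, hzq, hqr, hzr⟩ := this
    by_cases hqi : G.Adj (a i) q
    · by_cases hri : G.Adj (a i) r
      · obtain rfl := hd _ _ _ _ hqr hqi hri hzq hzr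
        exact (hz (i + 1) (ha _ _ (by fin_cases i <;> decide))).elim
      · exact ⟨r, q, fun j => if hj : j = i then hj ▸ hri else hr j hj, hq, hzr, hqr.symm, hzq⟩
    · exact ⟨q, r, fun j => if hj : j = i then hj ▸ hqi else hq j hj, hr, hzq, hqr, hzr⟩
  choose q r hq hr hzq hqr hzr using htri
  by_cases hrem : ∃ i, ∀ j, ¬G.Adj (a j) (r i)
  · obtain ⟨i, hri⟩ := hrem
    have key : ∀ p q r, (∀ j, ¬G.Adj (a j) p) → (∀ j, ¬G.Adj (a j) q) → (∀ j, ¬G.Adj (a j) r) →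
        G.Adj p q → G.Adj q r → G.Adj p r → ∀ j s t, s ∈ sector G a j → G.Adj (a j) s →
        t ∈ sector G a j → G.Adj (a j) t → G.Adj s t → ¬G.Adj p s := by
      intro p q r hp hq hr hpq hqr hpr j s t hs has ht hat hst hps
      exact (not_adj_of_triangle h hd ha hp (fun k _ => hq k) (fun k _ => hr k) hs hpq hqr hpr hps
        (fun k => hq j (k ▸ has)) (fun k => hr j (k ▸ has)) hs has ht hat hst).1 hps
    have k1 := key z (q i) (r i) hz (hq i) hri (hzq i) (hqr i) (hzr i)
    have k2 := key (q i) z (r i) (hq i) hz hri (hzq i).symm (hzr i) (hqr i)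
    exact not_anticomplete_edge h hd ha hx hax hy hay hxy (hzq i) hz (hq i)
      (fun j => k1 j _ _ (hx j) (hax j) (hy j) (hay j) (hxy j))
      (fun j => k1 j _ _ (hy j) (hay j) (hx j) (hax j) (hxy j).symm)
      (fun j => k2 j _ _ (hx j) (hax j) (hy j) (hay j) (hxy j))
      (fun j => k2 j _ _ (hy j) (hay j) (hx j) (hax j) (hxy j).symm)
  · push Not at hrem
    have har : ∀ i, G.Adj (a i) (r i) := by
      intro i
      obtain ⟨j, hj⟩ := hrem i
      by_cases hji : j = i
      · exact hji ▸ hj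
      · exact (hr i j hji hj).elim
    have key : ∀ j s t, s ∈ sector G a j → G.Adj (a j) s → t ∈ sector G a j → G.Adj (a j) t →
        G.Adj s t → ¬G.Adj z s ∧ ¬G.Adj (q 0) s := by
      intro j s t hs has ht hat hst
      have hj : j ≠ j + 1 := by fin_cases j <;> decide
      have := not_adj_of_triangle h hd ha hz (fun k _ => hq j k) (hr j)
        (fun k _ => hq (j + 1) k) (hzq j) (hqr j) (hzr j) (hzq (j + 1)) ?_ ?_ hs has ht hat hst
      · exact ⟨this.1, this.2 _ (fun k _ => hq 0 k) (hzq 0)⟩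
      · intro hqq
        have hrr : r j = r (j + 1) := hd _ _ _ _ (hzq j) (hzr j).symm (hqr j).symm
          (hzr (j + 1)).symm (hqq ▸ (hqr (j + 1)).symm)
        exact hr (j + 1) j hj (hrr ▸ har j)
      · intro hqr'
        exact hq (j + 1) j (hqr' ▸ har j)
    have k1 := fun j => key j _ _ (hx j) (hax j) (hy j) (hay j) (hxy j)
    have k2 := fun j => key j _ _ (hy j) (hay j) (hx j) (hax j) (hxy j).symm
    exact not_anticomplete_edge h hd ha hx hax hy hay hxy (hzq 0) hz (hq 0)
      (fun j => (k1 j).1) (fun j => (k2 j).1) (fun j => (k1 j).2) (fun j => (k2 j).2)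

lemma colorable_six_of_triangle (h : IsIndFree P2UP4 G) (hd : EdgeInOneTriangle G)
    (ha : ∀ i j, i ≠ j → G.Adj (a i) (a j)) : G.Colorable 6 := by
  by_cases hI : ∃ i, G.IsIndepSet {v | v ∈ sector G a i ∧ G.Adj (a i) v}
  · obtain ⟨i, hi⟩ := hI
    have h2 := (noInducedP4_sector h ha (i + 1)).colorable_three (hd.induce _)
    have h3 := colorable_two_triangleFreePart h hd ha (i + 2)
    refine colorable_of_cover_sectors hd ha i le_rfl (by decide) (by decide)
      (colorable_one_of_isIndepSet hi) h2 h3 (fun v hv => hv.1) subset_rfl (fun v hv => hv.1) ?_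
    intro j v hv
    by_cases hav : G.Adj (a j) v
    · have : j = i ∨ j = i + 1 ∨ j = i + 2 := by clear * -; revert i j; decide
      rcases this with rfl | rfl | rfl
      · exact Or.inl (Or.inl ⟨hv, hav⟩)
      · exact Or.inl (Or.inr hv)
      · exact Or.inr ⟨hv, Or.inl hav⟩
    · exact Or.inl (Or.inr fun k _ => if hk : k = j then hk ▸ hav else hv k hk)
  · have hedge : ∀ i, ∃ x y, x ∈ sector G a i ∧ G.Adj (a i) x ∧ y ∈ sector G a i ∧
        G.Adj (a i) y ∧ G.Adj x y := by
      intro i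
      by_contra! hc
      exact hI ⟨i, fun x hx y hy _ => hc x y hx.1 hx.2 hy.1 hy.2⟩
    choose x y hx hax hy hay hxy using hedge
    have hT := colorable_two_triangleFreePart h hd ha
    refine colorable_of_cover_sectors hd ha 0 (by decide) (by decide) (by decide)
      (hT 0) (hT 1) (hT 2) (fun v hv => hv.1) (fun v hv => hv.1) (fun v hv => hv.1) ?_
    intro j v hv
    obtain ⟨k, hk⟩ : ∃ k, v ∈ triangleFreePart G a k := by
      by_cases hav : G.Adj (a j) v
      · exact ⟨j, hv, Or.inl hav⟩
      · exact exists_mem_triangleFreePart h hd ha hx hax hy hay hxy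
          fun k => if hk : k = j then hk ▸ hav else hv k hk
    fin_cases k
    · exact Or.inl (Or.inl hk)
    · exact Or.inl (Or.inr hk)
    · exact Or.inr hk

end Sectors

theorem chi_le_six_of_omega_three_k_eq_three {V : Type*} [Fintype V] [DecidableEq V]
    (G : SimpleGraph V)
    (h1 : IsIndFree P2UP4 G) (h2 : IsIndFree diamond G) (hw : G.cliqueNum = 3)
    (A : Finset V) (hA : G.IsClique (A : Set V)) (hAmax : A.card = G.cliqueNum)
    (hk : (G.induce ((A : Set V)ᶜ)).cliqueNum = 3) :
    G.chromaticNumber ≤ 6 := by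
  have h4 : G.CliqueFree 4 := fun s hs => by
    have := hs.isClique.card_le_cliqueNum
    rw [hs.card_eq, hw] at this
    omega
  let e := A.equivFinOfCardEq (hAmax.trans hw)
  refine (colorable_six_of_triangle (a := fun i => (e.symm i : V)) h1
    (edgeInOneTriangle_of_isIndFree_diamond h2 h4) fun i j hij => ?_).chromaticNumber_le
  exact hA (e.symm i).2 (e.symm j).2 fun k => hij (e.symm.injective (Subtype.ext k))
end

section
/- Let G be a finite simple (P2 ∪ P4, diamond)-free graph, let A be a maximum clique of G with |A| = ω(G) ≥ 4, and let B be a maximum clique of G − A with |B| = k ≥ 4. Suppose the set of edges between A and B forms a matching (every vertex of A has at most one neighbour in B and every vertex of B has at most one neighbour in A). Let x and y be two vertices of G lying outside A ∪ B, each having at most one neighbour in A and at most one neighbour in B. If N(x) ∩ (A ∪ B) ≠ N(y) ∩ (A ∪ B) and |(N(x) ∪ N(y)) ∩ (A ∪ B)| ≤ 3, then x and y are not adjacent. -/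
open SimpleGraph

/-- In a `P2 ∪ P4`-free graph, every edge `pq` meets or is joined to every induced path `r s t u`. -/
lemma IsIndFree.not_edge_and_path {V : Type*} {G : SimpleGraph V} (h : IsIndFree P2UP4 G)
    {p q r s t u : V} (hpq : G.Adj p q) (hrs : G.Adj r s) (hst : G.Adj s t) (htu : G.Adj t u)
    (hrt : ¬ G.Adj r t) (hru : ¬ G.Adj r u) (hsu : ¬ G.Adj s u)
    (hp : ¬ G.Adj r p ∧ ¬ G.Adj s p ∧ ¬ G.Adj t p ∧ ¬ G.Adj u p)
    (hq : ¬ G.Adj r q ∧ ¬ G.Adj s q ∧ ¬ G.Adj t q ∧ ¬ G.Adj u q) : False := by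
  obtain ⟨hp1, hp2, hp3, hp4⟩ := hp
  obtain ⟨hq1, hq2, hq3, hq4⟩ := hq
  have hadj : ∀ i j : Fin 6,
      G.Adj (![p, q, r, s, t, u] i) (![p, q, r, s, t, u] j) ↔ P2UP4.Adj i j := by
    intro i j
    fin_cases i <;> fin_cases j <;> simp [P2UP4, *, G.adj_comm] <;>
      first | assumption | (rw [G.adj_comm]; assumption)
  refine h.elim ⟨⟨![p, q, r, s, t, u], ?_⟩, fun {i j} => hadj i j⟩
  have hsep : ∀ i j : Fin 6, (∀ k, P2UP4.Adj i k ↔ P2UP4.Adj j k) → i = j := by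
    simp only [P2UP4, SimpleGraph.fromRel_adj]
    decide
  intro i j hij
  exact hsep i j fun k => by rw [← hadj, ← hadj, hij]

/-- If `x a` extends to an induced path `y x a a'`, then both `a` and `a'` have a neighbour among
the at least three vertices of the clique `B` that are not adjacent to `x` or `y`. -/
lemma IsIndFree.exists_adj_of_path {V : Type*} {G : SimpleGraph V} [DecidableRel G.Adj]
    (h : IsIndFree P2UP4 G) {B : Finset V} (hB : G.IsClique (B : Set V)) {x y a a' : V}
    (hxy : G.Adj x y) (hxa : G.Adj x a) (hya : ¬ G.Adj y a) (haa' : G.Adj a a')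
    (hxa' : ¬ G.Adj x a') (hya' : ¬ G.Adj y a')
    (ha : ∀ b ∈ B, ∀ b' ∈ B, G.Adj a b → G.Adj a b' → b = b')
    (ha' : ∀ b ∈ B, ∀ b' ∈ B, G.Adj a' b → G.Adj a' b' → b = b')
    (hcard : 3 ≤ (B.filter fun b => ¬ (G.Adj x b ∨ G.Adj y b)).card) :
    (B.filter fun b => ¬ (G.Adj x b ∨ G.Adj y b)).card = 3 ∧
      (∃ b ∈ B.filter fun b => ¬ (G.Adj x b ∨ G.Adj y b), G.Adj a b) ∧
      ∃ b ∈ B.filter fun b => ¬ (G.Adj x b ∨ G.Adj y b), G.Adj a' b := by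
  classical
  set S := B.filter fun b => ¬ (G.Adj x b ∨ G.Adj y b) with hS
  have hmem : ∀ b, b ∈ S ↔ b ∈ B ∧ ¬ (G.Adj x b ∨ G.Adj y b) := by simp [hS]
  have hSa : (S.filter fun b => G.Adj a b).card ≤ 1 := by
    refine Finset.card_le_one.2 fun b hb c hc => ?_
    simp only [Finset.mem_filter, hmem] at hb hc
    exact ha b hb.1.1 c hc.1.1 hb.2 hc.2
  have hSa' : (S.filter fun b => G.Adj a' b).card ≤ 1 := by
    refine Finset.card_le_one.2 fun b hb c hc => ?_
    simp only [Finset.mem_filter, hmem] at hb hc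
    exact ha' b hb.1.1 c hc.1.1 hb.2 hc.2
  have hSn : (S.filter fun b => ¬ (G.Adj a b ∨ G.Adj a' b)).card ≤ 1 := by
    refine Finset.card_le_one.2 fun b hb c hc => ?_
    simp only [Finset.mem_filter, hmem, not_or] at hb hc
    by_contra hbc
    exact h.not_edge_and_path (hB hb.1.1 hc.1.1 hbc) hxy.symm hxa haa' hya hya' hxa'
      ⟨hb.1.2.2, hb.1.2.1, hb.2⟩ ⟨hc.1.2.2, hc.1.2.1, hc.2⟩
  have hsum := Finset.card_filter_add_card_filter_not (s := S) fun b => G.Adj a b ∨ G.Adj a' b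
  have hor : (S.filter fun b => G.Adj a b ∨ G.Adj a' b).card ≤
      (S.filter fun b => G.Adj a b).card + (S.filter fun b => G.Adj a' b).card := by
    rw [Finset.filter_or]
    exact Finset.card_union_le _ _
  refine ⟨by omega, ?_, ?_⟩
  · obtain ⟨b, hb⟩ := Finset.card_pos.1 (by omega : 0 < (S.filter fun b => G.Adj a b).card)
    exact ⟨b, Finset.mem_filter.1 hb⟩
  · obtain ⟨b, hb⟩ := Finset.card_pos.1 (by omega : 0 < (S.filter fun b => G.Adj a' b).card)
    exact ⟨b, Finset.mem_filter.1 hb⟩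

/-- An edge `xy` cannot be distinguished by a vertex `a` of a clique `A` if it has few neighbours
in `A` and at most one in a second clique `B` joined to `A` by a matching. -/
lemma IsIndFree.not_adj_of_distinguished {V : Type*} {G : SimpleGraph V} [DecidableRel G.Adj]
    (h : IsIndFree P2UP4 G) {A B : Finset V} (hA : G.IsClique (A : Set V))
    (hB : G.IsClique (B : Set V)) (hA4 : 4 ≤ A.card) (hB4 : 4 ≤ B.card)
    (hm1 : ∀ a ∈ A, ∀ b ∈ B, ∀ b' ∈ B, G.Adj a b → G.Adj a b' → b = b')
    (hm2 : ∀ b ∈ B, ∀ a ∈ A, ∀ a' ∈ A, G.Adj a b → G.Adj a' b → a = a') {x y a : V}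
    (hxA : (A.filter fun a => G.Adj x a).card ≤ 1)
    (hNA : (A.filter fun a => G.Adj x a ∨ G.Adj y a).card ≤ 3)
    (hNB : (B.filter fun b => G.Adj x b ∨ G.Adj y b).card ≤ 1)
    (haA : a ∈ A) (hxa : G.Adj x a) (hya : ¬ G.Adj y a) : ¬ G.Adj x y := by
  intro hxy
  have hsumA := Finset.card_filter_add_card_filter_not (s := A) fun a => G.Adj x a ∨ G.Adj y a
  have hsumB := Finset.card_filter_add_card_filter_not (s := B) fun b => G.Adj x b ∨ G.Adj y b
  have hS3 : 3 ≤ (B.filter fun b => ¬ (G.Adj x b ∨ G.Adj y b)).card := by omega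
  have hfree : ∀ v ∈ A, ¬ G.Adj x v → ¬ G.Adj y v →
      (B.filter fun b => ¬ (G.Adj x b ∨ G.Adj y b)).card = 3 ∧
      (∃ b ∈ B.filter fun b => ¬ (G.Adj x b ∨ G.Adj y b), G.Adj a b) ∧
      ∃ b ∈ B.filter fun b => ¬ (G.Adj x b ∨ G.Adj y b), G.Adj v b := fun v hv hxv hyv =>
    h.exists_adj_of_path hB hxy hxa hya (hA haA hv fun e => hxv (e ▸ hxa)) hxv hyv
      (hm1 a haA) (hm1 v hv) hS3
  obtain ⟨c, hc⟩ := Finset.card_pos.1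
    (by omega : 0 < (A.filter fun a => ¬ (G.Adj x a ∨ G.Adj y a)).card)
  simp only [Finset.mem_filter, not_or] at hc
  obtain ⟨hcA, hxc, hyc⟩ := hc
  obtain ⟨hcard, hab, -⟩ := hfree c hcA hxc hyc
  have hall : ∀ v ∈ A, ∃ b ∈ B.filter fun b => ¬ (G.Adj x b ∨ G.Adj y b), G.Adj v b := by
    intro v hv
    by_cases hxv : G.Adj x v
    · have hva : v = a := Finset.card_le_one.1 hxA v (by simp [hv, hxv]) a (by simp [haA, hxa])
      exact hva ▸ hab
    by_cases hyv : G.Adj y v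
    · have hpath := h.exists_adj_of_path hB hxy.symm hyv hxv
        (hA hv hcA fun e => hyc (e ▸ hyv)) hyc hxc (hm1 v hv) (hm1 c hcA)
        (by simpa only [or_comm] using hS3)
      simpa only [or_comm] using hpath.2.1
    · exact (hfree v hv hxv hyv).2.2
  choose! f hf hadj using hall
  have hle : A.card ≤ (B.filter fun b => ¬ (G.Adj x b ∨ G.Adj y b)).card := by
    refine Finset.card_le_card_of_injOn f hf fun v hv w hw hvw => ?_
    exact hm2 (f v) (Finset.mem_filter.1 (hf v hv)).1 v hv w hw (hadj v hv)
      (hvw ▸ hadj w hw)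
  omega

lemma exists_mem_not_of_card_filter_lt {α : Type*} {s : Finset α} {p q : α → Prop}
    [DecidablePred p] [DecidablePred q]
    (h : (s.filter q).card < (s.filter fun a => p a ∨ q a).card) : ∃ a ∈ s, p a ∧ ¬ q a := by
  by_contra! hpq
  refine absurd (Finset.card_le_card fun a ha => ?_) h.not_ge
  simp only [Finset.mem_filter] at ha ⊢
  exact ⟨ha.1, ha.2.elim (hpq a ha.1) id⟩

theorem nonadjacent_of_few_nbrs_in_A_union_B {V : Type*} [Fintype V] [DecidableEq V]
    (G : SimpleGraph V) [DecidableRel G.Adj]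
    (h1 : IsIndFree P2UP4 G) (h2 : IsIndFree diamond G)
    (A : Finset V) (hA : G.IsClique (A : Set V)) (hAmax : A.card = G.cliqueNum)
    (hw : 4 ≤ G.cliqueNum)
    (B : Finset V) (hAB : Disjoint A B) (hB : G.IsClique (B : Set V))
    (hBmax : B.card = (G.induce ((A : Set V)ᶜ)).cliqueNum) (hk : 4 ≤ B.card)
    (hm1 : ∀ a ∈ A, ∀ b ∈ B, ∀ b' ∈ B, G.Adj a b → G.Adj a b' → b = b')
    (hm2 : ∀ b ∈ B, ∀ a ∈ A, ∀ a' ∈ A, G.Adj a b → G.Adj a' b → a = a')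
    (x y : V) (hx : x ∉ A ∪ B) (hy : y ∉ A ∪ B)
    (hxA : (A.filter (fun a => G.Adj x a)).card ≤ 1)
    (hxB : (B.filter (fun b => G.Adj x b)).card ≤ 1)
    (hyA : (A.filter (fun a => G.Adj y a)).card ≤ 1)
    (hyB : (B.filter (fun b => G.Adj y b)).card ≤ 1)
    (hne : (A ∪ B).filter (fun w => G.Adj x w) ≠ (A ∪ B).filter (fun w => G.Adj y w))
    (hcard : ((A ∪ B).filter (fun w => G.Adj x w ∨ G.Adj y w)).card ≤ 3) :
    ¬ G.Adj x y := by
  intro hxy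
  have hsum : (A.filter fun w => G.Adj x w ∨ G.Adj y w).card +
      (B.filter fun w => G.Adj x w ∨ G.Adj y w).card ≤ 3 := by
    rwa [Finset.filter_union,
      Finset.card_union_of_disjoint (Finset.disjoint_filter_filter hAB)] at hcard
  have hA4 : 4 ≤ A.card := hAmax ▸ hw
  have hm1' : ∀ b ∈ B, ∀ a ∈ A, ∀ a' ∈ A, G.Adj b a → G.Adj b a' → a = a' :=
    fun b hb a ha a' ha' h h' => hm2 b hb a ha a' ha' h.symm h'.symm
  have hm2' : ∀ a ∈ A, ∀ b ∈ B, ∀ b' ∈ B, G.Adj b a → G.Adj b' a → b = b' :=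
    fun a ha b hb b' hb' h h' => hm1 a ha b hb b' hb' h.symm h'.symm
  rcases Nat.lt_or_ge 1 (B.filter fun w => G.Adj x w ∨ G.Adj y w).card with hNB | hNB
  · obtain ⟨u, hu, hxu, hyu⟩ := exists_mem_not_of_card_filter_lt (hyB.trans_lt hNB)
    exact h1.not_adj_of_distinguished hB hA hk hA4 hm1' hm2' hxB (by omega) (by omega)
      hu hxu hyu hxy
  rcases Nat.lt_or_ge 1 (A.filter fun w => G.Adj x w ∨ G.Adj y w).card with hNA | hNA
  · obtain ⟨u, hu, hxu, hyu⟩ := exists_mem_not_of_card_filter_lt (hyA.trans_lt hNA)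
    exact h1.not_adj_of_distinguished hA hB hA4 hk hm1 hm2 hxA (by omega) hNB hu hxu hyu hxy
  refine hne (Finset.filter_congr fun w hw' => ?_)
  have hNA' : (A.filter fun w => G.Adj y w ∨ G.Adj x w).card ≤ 1 := by
    simpa only [or_comm] using hNA
  have hNB' : (B.filter fun w => G.Adj y w ∨ G.Adj x w).card ≤ 1 := by
    simpa only [or_comm] using hNB
  rcases Finset.mem_union.1 hw' with hwA | hwB
  · constructor <;> intro hadj <;> by_contra hnadj
    · exact h1.not_adj_of_distinguished hA hB hA4 hk hm1 hm2 hxA (by omega) hNB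
        hwA hadj hnadj hxy
    · exact h1.not_adj_of_distinguished hA hB hA4 hk hm1 hm2 hyA (by omega) hNB'
        hwA hadj hnadj hxy.symm
  · constructor <;> intro hadj <;> by_contra hnadj
    · exact h1.not_adj_of_distinguished hB hA hk hA4 hm1' hm2' hxB (by omega) hNA
        hwB hadj hnadj hxy
    · exact h1.not_adj_of_distinguished hB hA hk hA4 hm1' hm2' hyB (by omega) hNA'
        hwB hadj hnadj hxy.symm
end

section
/- Let G be a finite simple (P2 ∪ P4, diamond)-free graph, let A = {a_1, a_2, a_3, a_4} be a maximum clique of G with ω(G) = 4, and let B = {b_1, b_2, b_3, b_4} be a maximum clique of G − A with ω(G − A) = 4. Suppose the set of edges between A and B forms a matching (every vertex of A has at most one neighbour in B and every vertex of B has at most one neighbour in A). For i, p ∈ {1, 2, 3, 4}, let S_i^p denote the set of vertices outside A ∪ B whose unique neighbour in A is a_i and whose unique neighbour in B is b_p. If for pairwise distinct i, j ∈ {1,2,3,4} and pairwise distinct p, q ∈ {1,2,3,4} some vertex of S_i^p is adjacent to some vertex of S_j^q, then for every q' ∈ {1,2,3,4} \ {p, q} no vertex of S_i^p is adjacent to any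 vertex of S_j^{q'}, and for every j' ∈ {1,2,3,4} \ {i, j} no vertex of S_i^p is adjacent to any vertex of S_{j'}^q. -/
open SimpleGraph

/-- The set of vertices outside the ranges of `a` and `b` whose unique neighbour among the
`a j` is `a i` and whose unique neighbour among the `b q` is `b p`. -/
def privNbrSet {V ι κ : Type*} (G : SimpleGraph V) (a : ι → V) (b : κ → V)
    (i : ι) (p : κ) : Set V :=
  {v | v ∉ Set.range a ∧ v ∉ Set.range b ∧
    (∀ j, G.Adj v (a j) ↔ j = i) ∧ (∀ q, G.Adj v (b q) ↔ q = p)}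

theorem false_of_edge_of_path {V : Type*} {G : SimpleGraph V} (h : IsIndFree P2UP4 G)
    {c d x y z t : V} (hcd : G.Adj c d) (hxy : G.Adj x y) (hyz : G.Adj y z) (hzt : G.Adj z t)
    (hxz : ¬ G.Adj x z) (hxt : ¬ G.Adj x t) (hyt : ¬ G.Adj y t)
    (hxc : ¬ G.Adj x c) (hxd : ¬ G.Adj x d) (hyc : ¬ G.Adj y c) (hyd : ¬ G.Adj y d)
    (hzc : ¬ G.Adj z c) (hzd : ¬ G.Adj z d) (htc : ¬ G.Adj t c) (htd : ¬ G.Adj t d) :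
    False := by
  have key : ∀ m n : Fin 6, G.Adj (![c, d, x, y, z, t] m) (![c, d, x, y, z, t] n) ↔
      P2UP4.Adj m n := by
    intro m n
    fin_cases m <;> fin_cases n <;> simp [P2UP4] <;> grind [SimpleGraph.adj_comm]
  have separated : ∀ m n : Fin 6, (∀ l, P2UP4.Adj m l ↔ P2UP4.Adj n l) → m = n := by
    simp only [P2UP4, fromRel_adj]
    decide
  exact h.false ⟨⟨![c, d, x, y, z, t], fun m n hmn => separated m n fun l => by
    rw [← key, ← key, hmn]⟩, key _ _⟩

theorem adj_of_two_common_neighbors {V : Type*} {G : SimpleGraph V} (h : IsIndFree diamond G)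
    {x y z t : V} (hxy : x ≠ y) (hzt : G.Adj z t) (hxz : G.Adj x z) (hxt : G.Adj x t)
    (hyz : G.Adj y z) (hyt : G.Adj y t) : G.Adj x y := by
  by_contra hn
  have key : ∀ m n : Fin 4, G.Adj (![x, y, z, t] m) (![x, y, z, t] n) ↔ diamond.Adj m n := by
    intro m n
    fin_cases m <;> fin_cases n <;> simp [diamond, *, hzt.symm, hxz.symm, hxt.symm, hyz.symm,
      hyt.symm, G.adj_comm y x]
  refine h.false ⟨⟨![x, y, z, t], ?_⟩, key _ _⟩
  intro m n hmn
  have := hzt.ne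
  have := hxz.ne
  have := hxt.ne
  have := hyz.ne
  have := hyt.ne
  fin_cases m <;> fin_cases n <;> simp_all

set_option maxHeartbeats 1000000 in
theorem not_adj_privNbrSet_of_adj {V : Type*} {G : SimpleGraph V}
    (h1 : IsIndFree P2UP4 G) (h2 : IsIndFree diamond G)
    {a b : Fin 4 → V}
    (ha : Function.Injective a) (hA : G.IsClique (Set.range a))
    (hb : Function.Injective b) (hB : G.IsClique (Set.range b))
    (hm1 : ∀ i q q', G.Adj (a i) (b q) → G.Adj (a i) (b q') → q = q')
    (hm2 : ∀ q i i', G.Adj (a i) (b q) → G.Adj (a i') (b q) → i = i')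
    {i j p q q' : Fin 4} (hij : i ≠ j) (hpq : p ≠ q) (hq'p : q' ≠ p) (hq'q : q' ≠ q)
    {u w u' w' : V} (hu : u ∈ privNbrSet G a b i p) (hw : w ∈ privNbrSet G a b j q)
    (huw : G.Adj u w) (hu' : u' ∈ privNbrSet G a b i p) (hw' : w' ∈ privNbrSet G a b j q') :
    ¬ G.Adj u' w' := by
  intro huw'
  obtain ⟨k, l, hki, hkj, hli, hlj, hkl⟩ : ∃ k l : Fin 4,
      k ≠ i ∧ k ≠ j ∧ l ≠ i ∧ l ≠ j ∧ k ≠ l := by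
    clear * - hij; revert i j; decide
  obtain ⟨r, hrp, hrq, hrq'⟩ : ∃ r : Fin 4, r ≠ p ∧ r ≠ q ∧ r ≠ q' := by
    clear * - hpq hq'p hq'q; revert p q q'; decide
  have adjA : ∀ m n, G.Adj (a m) (a n) ↔ m ≠ n := fun m n =>
    ⟨fun h e => h.ne (e ▸ rfl), fun h => hA ⟨m, rfl⟩ ⟨n, rfl⟩ (ha.ne h)⟩
  have adjB : ∀ m n, G.Adj (b m) (b n) ↔ m ≠ n := fun m n =>
    ⟨fun h e => h.ne (e ▸ rfl), fun h => hB ⟨m, rfl⟩ ⟨n, rfl⟩ (hb.ne h)⟩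
  obtain ⟨-, -, hua, hub⟩ := hu
  obtain ⟨-, -, hwa, hwb⟩ := hw
  obtain ⟨-, -, hua', hub'⟩ := hu'
  obtain ⟨-, -, hwa', hwb'⟩ := hw'
  have sym : ∀ x y, G.Adj x y → G.Adj y x := fun _ _ h => h.symm
  -- A path ending in `b m` forces `b m` to have a neighbour in the edge `a k`, `a l`.
  have forced : ∀ {x y z m}, G.Adj x y → G.Adj y z → G.Adj z (b m) → ¬ G.Adj x z →
      ¬ G.Adj x (b m) → ¬ G.Adj y (b m) → ¬ G.Adj x (a k) → ¬ G.Adj x (a l) →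
      ¬ G.Adj y (a k) → ¬ G.Adj y (a l) → ¬ G.Adj z (a k) → ¬ G.Adj z (a l) →
      G.Adj (a k) (b m) ∨ G.Adj (a l) (b m) := by
    intro x y z m hxy hyz hzm hxz hxm hym hxk hxl hyk hyl hzk hzl
    by_contra! hc
    exact false_of_edge_of_path h1 ((adjA k l).2 hkl) hxy hyz hzm hxz hxm hym hxk hxl hyk hyl
      hzk hzl (fun h => hc.1 h.symm) (fun h => hc.2 h.symm)
  -- Matching both `b q` and `b q'` outside `a i`, `a j` leaves room for a path off `b q'`, `b r`.
  have matched : ∀ m n, m ≠ i → m ≠ j → n ≠ i → n ≠ j → m ≠ n → G.Adj (a m) (b q) →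
      ¬ G.Adj (a n) (b q') := by
    intro m n hmi hmj hni hnj hmn hmq hnq'
    have hjr : G.Adj (a j) (b r) := by
      by_contra hjr
      apply false_of_edge_of_path h1 (c := b q') (d := b r) (x := u) (y := w) (z := a j)
        (t := a m) <;> grind
    apply false_of_edge_of_path h1 (c := b q') (d := b r) (x := w) (y := u) (z := a i)
      (t := a m) <;> grind
  have notBoth : (G.Adj (a k) (b q) ∨ G.Adj (a l) (b q)) →
      (G.Adj (a k) (b q') ∨ G.Adj (a l) (b q')) → False := by
    grind
  have noCommon : ∀ v, (∀ m, G.Adj v (a m) ↔ m = i) → (∀ m, G.Adj v (b m) ↔ m = p) →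
      G.Adj v w → ¬ G.Adj v w' := by
    intro v hva hvb hvw hvw'
    have hww' : ¬ G.Adj w w' := fun h => hij.symm <| (hva j).1 <|
      adj_of_two_common_neighbors h2 (y := a j)
        (fun h => hki ((hva k).1 (h ▸ (adjA j k).2 hkj.symm)))
        h hvw hvw' ((hwa j).2 rfl).symm ((hwa' j).2 rfl).symm
    apply notBoth
    · apply forced (x := w') (y := v) (z := w) <;> grind
    · apply forced (x := w) (y := v) (z := w') <;> grind
  have huw'n : ¬ G.Adj u w' := noCommon u hua hub huw
  have hu'wn : ¬ G.Adj u' w := fun h => noCommon u' hua' hub' h huw'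
  by_cases huu' : G.Adj u u' <;> by_cases hww' : G.Adj w w'
  · apply notBoth
    · apply forced (x := u') (y := u) (z := w) <;> grind
    · apply forced (x := u) (y := u') (z := w') <;> grind
  · apply false_of_edge_of_path h1 (c := a k) (d := a l) (x := w) (y := u) (z := u')
      (t := w') <;> grind
  · apply false_of_edge_of_path h1 (c := a k) (d := a l) (x := u) (y := w) (z := w')
      (t := u') <;> grind
  · have hiq' : G.Adj (a i) (b q') ∨ G.Adj (a i) (b r) := by
      by_contra! hc
      apply false_of_edge_of_path h1 (c := b q') (d := b r) (x := w) (y := u) (z := a i)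
        (t := u') <;> grind
    have hiq : G.Adj (a i) (b q) ∨ G.Adj (a i) (b r) := by
      by_contra! hc
      apply false_of_edge_of_path h1 (c := b q) (d := b r) (x := w') (y := u') (z := a i)
        (t := u) <;> grind
    have hir : G.Adj (a i) (b r) := by grind
    apply notBoth
    · by_contra! hc
      apply false_of_edge_of_path h1 (c := a k) (d := a l) (x := u) (y := w) (z := b q)
        (t := b r) <;> grind
    · by_contra! hc
      apply false_of_edge_of_path h1 (c := a k) (d := a l) (x := u') (y := w') (z := b q')
        (t := b r) <;> grind

theorem S_sets_anticomplete_case_omega_four {V : Type*} [Fintype V] (G : SimpleGraph V)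
    (h1 : IsIndFree P2UP4 G) (h2 : IsIndFree diamond G)
    (hw : G.cliqueNum = 4)
    (a : Fin 4 → V) (ha : Function.Injective a) (hA : G.IsClique (Set.range a))
    (hk : (G.induce ((Set.range a)ᶜ)).cliqueNum = 4)
    (b : Fin 4 → V) (hb : Function.Injective b) (hB : G.IsClique (Set.range b))
    (hbA : ∀ q, b q ∉ Set.range a)
    (hm1 : ∀ i q q', G.Adj (a i) (b q) → G.Adj (a i) (b q') → q = q')
    (hm2 : ∀ q i i', G.Adj (a i) (b q) → G.Adj (a i') (b q) → i = i')
    (i j p q : Fin 4) (hij : i ≠ j) (hpq : p ≠ q)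
    (hadj : ∃ u ∈ privNbrSet G a b i p, ∃ w ∈ privNbrSet G a b j q, G.Adj u w) :
    (∀ q', q' ≠ p → q' ≠ q →
      ∀ u ∈ privNbrSet G a b i p, ∀ w ∈ privNbrSet G a b j q', ¬ G.Adj u w) ∧
    (∀ j', j' ≠ i → j' ≠ j →
      ∀ u ∈ privNbrSet G a b i p, ∀ w ∈ privNbrSet G a b j' q, ¬ G.Adj u w) := by
  obtain ⟨u, hu, w, hw, huw⟩ := hadj
  refine ⟨fun q' hp hq u' hu' w' hw' =>
    not_adj_privNbrSet_of_adj h1 h2 ha hA hb hB hm1 hm2 hij hpq hp hq hu hw huw hu' hw',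
    fun j' hi hj u' hu' w' hw' => ?_⟩
  have swap : ∀ {x m n}, x ∈ privNbrSet G a b m n → x ∈ privNbrSet G b a n m :=
    fun h => ⟨h.2.1, h.1, h.2.2.2, h.2.2.1⟩
  exact not_adj_privNbrSet_of_adj h1 h2 hb hB ha hA
    (fun m n n' h h' => hm2 m n n' h.symm h'.symm)
    (fun m n n' h h' => hm1 m n n' h.symm h'.symm)
    hpq hij hi hj (swap hu) (swap hw) huw (swap hu') (swap hw')
end

section
/- Let G be a finite simple (P2 ∪ P4, diamond)-free graph, let A = {a_1, …, a_ω} be a maximum clique of G with ω = ω(G) ≥ 5, and let B = {b_1, …, b_k} be a maximum clique of G − A with k = ω(G − A) ≥ 4. Suppose the set of edges between A and B forms a matching (every vertex of A has at most one neighbour in B and every vertex of B has at most one neighbour in A). For i ∈ {1,…,ω} and p ∈ {1,…,k}, let S_i^p denote the set of vertices outside A ∪ B whose unique neighbour in A is a_i and whose unique neighbour in B is b_p. Then for all distinct i, j ∈ {1,…,ω} and all distinct p, q ∈ {1,…,k}, no vertex of S_i^p is adjacent to any vertex of S_j^q. -/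
open SimpleGraph

/-- Six vertices with the adjacencies and non-adjacencies of `P2 ∪ P4` do not exist in a
`P2 ∪ P4`-free graph; distinctness is automatic, as `P2 ∪ P4` has no twin vertices. -/
lemma IsIndFree.false_of_P2UP4 {V : Type*} {G : SimpleGraph V} (h : IsIndFree P2UP4 G)
    {x y c d e f : V} (hxy : G.Adj x y) (hcd : G.Adj c d) (hde : G.Adj d e) (hef : G.Adj e f)
    (hce : ¬ G.Adj c e) (hcf : ¬ G.Adj c f) (hdf : ¬ G.Adj d f)
    (hxc : ¬ G.Adj x c) (hxd : ¬ G.Adj x d) (hxe : ¬ G.Adj x e) (hxf : ¬ G.Adj x f)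
    (hyc : ¬ G.Adj y c) (hyd : ¬ G.Adj y d) (hye : ¬ G.Adj y e) (hyf : ¬ G.Adj y f) :
    False := by
  have hadj : ∀ s t : Fin 6,
      G.Adj (![x, y, c, d, e, f] s) (![x, y, c, d, e, f] t) ↔ P2UP4.Adj s t := by
    intro s t
    fin_cases s <;> fin_cases t <;> simp_all [P2UP4, G.adj_comm]
  have twin_free : ∀ s t : Fin 6, (∀ z, P2UP4.Adj s z ↔ P2UP4.Adj t z) → s = t := by
    simp only [P2UP4, SimpleGraph.fromRel_adj]
    decide
  refine h.false ⟨⟨![x, y, c, d, e, f], fun s t hst => twin_free s t fun z => ?_⟩, hadj _ _⟩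
  rw [← hadj, ← hadj, hst]

lemma Fin.exists_notMem_of_card_lt {n : ℕ} (s : Finset (Fin n)) (hs : s.card < n) :
    ∃ x, x ∉ s := by
  by_contra! h
  simp [Finset.eq_univ_iff_forall.2 h] at hs

/-- In a nonempty type, a predicate satisfied at most once has all its witnesses equal to some
fixed element. -/
lemma exists_forall_imp_eq {α : Type*} [Nonempty α] {P : α → Prop}
    (h : ∀ x y, P x → P y → x = y) : ∃ x, ∀ y, P y → y = x := by
  by_cases hP : ∃ x, P x
  · obtain ⟨x, hx⟩ := hP
    exact ⟨x, fun y hy => h y x hy hx⟩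
  · exact ⟨Classical.arbitrary α, fun y hy => (hP ⟨y, hy⟩).elim⟩

theorem S_sets_anticomplete_case_omega_ge_five {V : Type*} [Fintype V] (G : SimpleGraph V)
    (h1 : IsIndFree P2UP4 G) (h2 : IsIndFree diamond G)
    (hw : 5 ≤ G.cliqueNum)
    (a : Fin G.cliqueNum → V) (ha : Function.Injective a) (hA : G.IsClique (Set.range a))
    (hk : 4 ≤ (G.induce ((Set.range a)ᶜ)).cliqueNum)
    (b : Fin ((G.induce ((Set.range a)ᶜ)).cliqueNum) → V) (hb : Function.Injective b)
    (hB : G.IsClique (Set.range b)) (hbA : ∀ q, b q ∉ Set.range a)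
    (hm1 : ∀ i q q', G.Adj (a i) (b q) → G.Adj (a i) (b q') → q = q')
    (hm2 : ∀ q i i', G.Adj (a i) (b q) → G.Adj (a i') (b q) → i = i')
    (i j : Fin G.cliqueNum) (hij : i ≠ j)
    (p q : Fin ((G.induce ((Set.range a)ᶜ)).cliqueNum)) (hpq : p ≠ q) :
    ∀ u ∈ privNbrSet G a b i p, ∀ w ∈ privNbrSet G a b j q, ¬ G.Adj u w := by
  rintro u ⟨-, -, hua, hub⟩ w ⟨-, -, hwa, hwb⟩ huw
  have hAadj : ∀ l m, l ≠ m → G.Adj (a l) (a m) := fun l m hlm =>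
    hA ⟨l, rfl⟩ ⟨m, rfl⟩ (ha.ne hlm)
  have hBadj : ∀ r s, r ≠ s → G.Adj (b r) (b s) := fun r s hrs =>
    hB ⟨r, rfl⟩ ⟨s, rfl⟩ (hb.ne hrs)
  have : Nonempty (Fin G.cliqueNum) := ⟨i⟩
  by_cases hE : ∃ l r, l ≠ i ∧ l ≠ j ∧ r ≠ p ∧ r ≠ q ∧ G.Adj (a l) (b r)
  · obtain ⟨l, r, hli, hlj, hrp, hrq, hlr⟩ := hE
    obtain ⟨s, hs⟩ := Fin.exists_notMem_of_card_lt {p, q, r} (Finset.card_le_three.trans_lt hk)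
    obtain ⟨x, hx⟩ := exists_forall_imp_eq (hm2 s)
    obtain ⟨m, hm⟩ := Fin.exists_notMem_of_card_lt {i, j, l, x}
      (Finset.card_le_four.trans_lt hw)
    simp only [Finset.mem_insert, Finset.mem_singleton, not_or] at hs hm
    apply h1.false_of_P2UP4 huw (hAadj m l hm.2.2.1) hlr (hBadj r s (Ne.symm hs.2.2)) <;>
      grind
  · push Not at hE
    obtain ⟨r, hr⟩ := Fin.exists_notMem_of_card_lt {p, q}
      (Finset.card_le_two.trans_lt (by omega))
    obtain ⟨x, hx⟩ := exists_forall_imp_eq (hm2 p)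
    obtain ⟨l, hl⟩ := Fin.exists_notMem_of_card_lt {i, j, x}
      (Finset.card_le_three.trans_lt (by omega))
    obtain ⟨m, hm⟩ := Fin.exists_notMem_of_card_lt {i, j, x, l}
      (Finset.card_le_four.trans_lt hw)
    simp only [Finset.mem_insert, Finset.mem_singleton, not_or] at hr hl hm
    apply h1.false_of_P2UP4 (hAadj m l hm.2.2.2) (hBadj r p hr.1) ((hub p).2 rfl).symm huw <;>
      grind [G.adj_comm]
end

section
/- There exists a finite simple (P2 ∪ P4, diamond)-free graph G with ω(G) = 2 and χ(G) = 4; in particular, the Mycielski–Grötzsch graph (the Mycielskian of the 5-cycle, an 11-vertex triangle-free graph) is such a graph. Hence the bound χ(G) ≤ 4 for (P2 ∪ P4, diamond)-free graphs with ω(G) = 2 is tight. -/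
open SimpleGraph

/-- The Mycielskian of a graph `G`. -/
def mycielskian {V : Type*} (G : SimpleGraph V) : SimpleGraph (V ⊕ V ⊕ Unit) :=
  SimpleGraph.fromRel (fun x y =>
    match x, y with
    | Sum.inl u, Sum.inl v => G.Adj u v
    | Sum.inl u, Sum.inr (Sum.inl v) => G.Adj u v
    | Sum.inr (Sum.inl u), Sum.inl v => G.Adj u v
    | Sum.inr (Sum.inl _), Sum.inr (Sum.inr _) => True
    | Sum.inr (Sum.inr _), Sum.inr (Sum.inl _) => True
    | _, _ => False)

/-- The Mycielski–Grötzsch graph: the Mycielskian of the 5-cycle. -/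
def grotzschGraph : SimpleGraph (Fin 5 ⊕ Fin 5 ⊕ Unit) :=
  mycielskian (SimpleGraph.cycleGraph 5)

namespace mycielskian

variable {V : Type*} {G : SimpleGraph V} {u v : V} {t : Unit}

@[simp] lemma adj_inl_inl : (mycielskian G).Adj (.inl u) (.inl v) ↔ G.Adj u v := by
  simpa [mycielskian, G.adj_comm v u] using fun h : G.Adj u v => h.ne

@[simp] lemma adj_inl_inr_inl :
    (mycielskian G).Adj (.inl u) (.inr (.inl v)) ↔ G.Adj u v := by
  simp [mycielskian, G.adj_comm v u]

@[simp] lemma adj_inr_inl_inl :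
    (mycielskian G).Adj (.inr (.inl u)) (.inl v) ↔ G.Adj u v := by
  simp [mycielskian, G.adj_comm v u]

@[simp] lemma not_adj_inl_inr_inr : ¬(mycielskian G).Adj (.inl u) (.inr (.inr t)) := by
  simp [mycielskian]

@[simp] lemma not_adj_inr_inr_inl : ¬(mycielskian G).Adj (.inr (.inr t)) (.inl u) := by
  simp [mycielskian]

@[simp] lemma not_adj_inr_inl_inr_inl :
    ¬(mycielskian G).Adj (.inr (.inl u)) (.inr (.inl v)) := by
  simp [mycielskian]

@[simp] lemma adj_inr_inl_inr_inr :
    (mycielskian G).Adj (.inr (.inl u)) (.inr (.inr t)) := by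
  simp [mycielskian]

@[simp] lemma adj_inr_inr_inr_inl :
    (mycielskian G).Adj (.inr (.inr t)) (.inr (.inl u)) := by
  simp [mycielskian]

instance [DecidableRel G.Adj] : DecidableRel (mycielskian G).Adj
  | .inl _, .inl _ => decidable_of_iff _ adj_inl_inl.symm
  | .inl _, .inr (.inl _) => decidable_of_iff _ adj_inl_inr_inl.symm
  | .inr (.inl _), .inl _ => decidable_of_iff _ adj_inr_inl_inl.symm
  | .inl _, .inr (.inr _) => .isFalse not_adj_inl_inr_inr
  | .inr (.inr _), .inl _ => .isFalse not_adj_inr_inr_inl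
  | .inr (.inl _), .inr (.inl _) => .isFalse not_adj_inr_inl_inr_inl
  | .inr (.inl _), .inr (.inr _) => .isTrue adj_inr_inl_inr_inr
  | .inr (.inr _), .inr (.inl _) => .isTrue adj_inr_inr_inr_inl
  | .inr (.inr _), .inr (.inr _) => .isFalse (SimpleGraph.irrefl _)

lemma colorable_succ {n : ℕ} (h : G.Colorable n) : (mycielskian G).Colorable (n + 1) := by
  obtain ⟨c⟩ := h
  refine ⟨Coloring.mk (fun x => match x with
    | .inl v => (c v).castSucc
    | .inr (.inl v) => (c v).castSucc
    | .inr (.inr _) => Fin.last n) ?_⟩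
  rintro (u | u | t) (v | v | t) h
  · simpa using c.valid (adj_inl_inl.1 h)
  · simpa using c.valid (adj_inl_inr_inl.1 h)
  · simp at h
  · simpa using c.valid (adj_inr_inl_inl.1 h)
  · simp at h
  · exact (Fin.castSucc_lt_last _).ne
  · simp at h
  · exact (Fin.castSucc_lt_last _).ne'
  · simp at h

/-- Recolouring each vertex that has the colour of the apex with the colour of its copy frees
the colour of the apex. -/
lemma colorable_of_colorable_succ {n : ℕ} (h : (mycielskian G).Colorable (n + 1)) :
    G.Colorable n := by
  obtain ⟨c⟩ := h
  set k := c (.inr (.inr ())) with hk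
  have hcopy (v : V) : c (.inr (.inl v)) ≠ k := c.valid adj_inr_inl_inr_inr
  let d : V → {x : Fin (n + 1) // x ≠ k} := fun v =>
    if hv : c (.inl v) = k then ⟨c (.inr (.inl v)), hcopy v⟩ else ⟨c (.inl v), hv⟩
  have hd {u v : V} (huv : G.Adj u v) : d u ≠ d v := by
    have h1 := c.valid (adj_inl_inl.2 huv)
    have h2 := c.valid (adj_inl_inr_inl.2 huv)
    have h3 := c.valid (adj_inr_inl_inl.2 huv)
    by_cases hu : c (.inl u) = k <;> by_cases hv : c (.inl v) = k <;>
      simp_all [d]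
  simpa using (Coloring.mk d hd).colorable

end mycielskian

lemma chromaticNumber_grotzschGraph : grotzschGraph.chromaticNumber = 4 := by
  have h := chromaticNumber_cycleGraph_of_odd 5 (by norm_num) (by decide)
  obtain ⟨h3, h2⟩ := (chromaticNumber_eq_iff_colorable_not_colorable (n := 2)).1 h
  exact (chromaticNumber_eq_iff_colorable_not_colorable (n := 3)).2
    ⟨mycielskian.colorable_succ h3, fun h => h2 (mycielskian.colorable_of_colorable_succ h)⟩

instance : DecidableRel grotzschGraph.Adj :=
  inferInstanceAs (DecidableRel (mycielskian (cycleGraph 5)).Adj)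

lemma cliqueFree_three_grotzschGraph : grotzschGraph.CliqueFree 3 := by
  have key : ∀ a b, grotzschGraph.Adj a b → ∀ c, grotzschGraph.Adj a c →
      ¬grotzschGraph.Adj b c := by decide +kernel
  intro s hs
  obtain ⟨a, b, c, hab, hac, hbc, -⟩ := is3Clique_iff.1 hs
  exact key a b hab c hac hbc

lemma cliqueNum_grotzschGraph : grotzschGraph.cliqueNum = 2 := by
  apply le_antisymm
  · obtain ⟨s, hs⟩ := grotzschGraph.exists_isNClique_cliqueNum
    by_contra! h
    exact cliqueFree_three_grotzschGraph.mono h s hs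
  · have h : grotzschGraph.Adj (.inr (.inl 0)) (.inr (.inr ())) := mycielskian.adj_inr_inl_inr_inr
    have hc : grotzschGraph.IsClique
        (({.inr (.inl 0), .inr (.inr ())} : Finset (Fin 5 ⊕ Fin 5 ⊕ Unit)) : Set _) := by
      simpa [isClique_pair] using h
    exact hc.card_le_cliqueNum

lemma isIndFree_diamond_of_cliqueFree_three {V : Type*} {G : SimpleGraph V}
    (hG : G.CliqueFree 3) : IsIndFree diamond G := by
  classical
  refine ⟨fun f => hG {f 0, f 2, f 3} (is3Clique_triple_iff.2 ⟨?_, ?_, ?_⟩)⟩ <;>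
    exact f.map_rel_iff.2 (by simp [diamond])

set_option synthInstance.maxSize 1000 in
lemma isIndFree_P2UP4_grotzschGraph : IsIndFree P2UP4 grotzschGraph := by
  have key : ∀ a b, grotzschGraph.Adj a b →
      ∀ c, ¬grotzschGraph.Adj a c → ¬grotzschGraph.Adj b c →
      ∀ d, grotzschGraph.Adj c d → ¬grotzschGraph.Adj a d → ¬grotzschGraph.Adj b d →
      ∀ e, grotzschGraph.Adj d e → ¬grotzschGraph.Adj a e → ¬grotzschGraph.Adj b e → c ≠ e →
      ∀ x, grotzschGraph.Adj e x → ¬grotzschGraph.Adj a x → ¬grotzschGraph.Adj b x →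
        ¬grotzschGraph.Adj c x → d = x := by decide +kernel
  refine ⟨fun f => ?_⟩
  have adj {i j : Fin 6} (h : P2UP4.Adj i j) : grotzschGraph.Adj (f i) (f j) :=
    f.map_rel_iff.2 h
  have nadj {i j : Fin 6} (h : ¬P2UP4.Adj i j) : ¬grotzschGraph.Adj (f i) (f j) :=
    mt f.map_rel_iff.1 h
  refine f.injective.ne (show (3 : Fin 6) ≠ 5 by decide)
    (key (f 0) (f 1) (adj ?_) (f 2) (nadj ?_) (nadj ?_) (f 3) (adj ?_) (nadj ?_) (nadj ?_)
      (f 4) (adj ?_) (nadj ?_) (nadj ?_) (f.injective.ne (by decide))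
      (f 5) (adj ?_) (nadj ?_) (nadj ?_) (nadj ?_)) <;>
    simp [P2UP4]

theorem grotzsch_shows_tightness :
    IsIndFree P2UP4 grotzschGraph ∧ IsIndFree diamond grotzschGraph ∧
    grotzschGraph.cliqueNum = 2 ∧ grotzschGraph.chromaticNumber = 4 :=
  ⟨isIndFree_P2UP4_grotzschGraph,
    isIndFree_diamond_of_cliqueFree_three cliqueFree_three_grotzschGraph,
    cliqueNum_grotzschGraph, chromaticNumber_grotzschGraph⟩
end

section
/- For every integer n ≥ 4, the graph H_n obtained from the disjoint union of a complete graph K_n and a 5-cycle C_5 by identifying one edge of K_n with one edge of C_5 is (P2 ∪ P4, diamond)-free, satisfies χ(H_n) = ω(H_n) = n, and contains an induced cycle of length 5 (hence H_n is not perfect). -/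
open SimpleGraph

/-- The graph `H n` obtained by identifying an edge of `K n` (on `Fin n`, whose vertices
`0` and `1` are the identified edge) with an edge of a `C 5`; the three remaining
vertices of the `C 5` are `Sum.inr 0, Sum.inr 1, Sum.inr 2`, forming the path
`(inl 0) - (inr 0) - (inr 1) - (inr 2) - (inl 1)`. -/
def Hgraph (n : ℕ) : SimpleGraph (Fin n ⊕ Fin 3) :=
  SimpleGraph.fromRel (fun x y =>
    match x, y with
    | Sum.inl _, Sum.inl _ => True
    | Sum.inl i, Sum.inr c => ((i : ℕ) = 0 ∧ (c : ℕ) = 0) ∨ ((i : ℕ) = 1 ∧ (c : ℕ) = 2)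
    | Sum.inr c, Sum.inr d => (d : ℕ) = (c : ℕ) + 1
    | _, _ => False)

/-- A graph is perfect if every induced subgraph has chromatic number equal to
its clique number. -/
def IsPerfect {V : Type*} (G : SimpleGraph V) : Prop :=
  ∀ s : Set V, (G.induce s).chromaticNumber = ((G.induce s).cliqueNum : ℕ∞)

open Finset in
/-- Every set of vertices of `P2UP4` whose complement is a clique has at least four elements. -/
lemma four_le_card_of_compl_clique (s : Finset (Fin 6))
    (hs : ∀ i j, i ≠ j → ¬ P2UP4.Adj i j → i ∈ s ∨ j ∈ s) : 4 ≤ #s := by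
  simp only [P2UP4, fromRel_adj] at hs
  revert s
  decide

lemma Hgraph_adj_inl_inl {n : ℕ} (i j : Fin n) :
    (Hgraph n).Adj (.inl i) (.inl j) ↔ i ≠ j := by
  simp [Hgraph]

lemma Hgraph_adj_inl_inr {n : ℕ} (i : Fin n) (c : Fin 3) :
    (Hgraph n).Adj (.inl i) (.inr c) ↔
      ((i : ℕ) = 0 ∧ (c : ℕ) = 0) ∨ ((i : ℕ) = 1 ∧ (c : ℕ) = 2) := by
  simp [Hgraph]

lemma Hgraph_adj_inr_inl {n : ℕ} (c : Fin 3) (i : Fin n) :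
    (Hgraph n).Adj (.inr c) (.inl i) ↔
      ((i : ℕ) = 0 ∧ (c : ℕ) = 0) ∨ ((i : ℕ) = 1 ∧ (c : ℕ) = 2) := by
  rw [adj_comm, Hgraph_adj_inl_inr]

lemma Hgraph_adj_inr_inr {n : ℕ} (c d : Fin 3) :
    (Hgraph n).Adj (.inr c) (.inr d) ↔ (d : ℕ) = c + 1 ∨ (c : ℕ) = d + 1 := by
  simp only [Hgraph, fromRel_adj, ne_eq, Sum.inr.injEq, Fin.ext_iff]
  omega

/-- Every triangle of `Hgraph n` lies in its complete part. -/
lemma Hgraph_isLeft_of_triangle {n : ℕ} {x y z : Fin n ⊕ Fin 3} (hxy : (Hgraph n).Adj x y)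
    (hxz : (Hgraph n).Adj x z) (hyz : (Hgraph n).Adj y z) : x.isLeft := by
  rcases x with x | x
  · rfl
  · rcases y with y | y <;> rcases z with z | z <;>
      simp only [Hgraph_adj_inl_inl, Hgraph_adj_inl_inr, Hgraph_adj_inr_inl,
        Hgraph_adj_inr_inr, ne_eq, Fin.ext_iff] at hxy hxz hyz <;> omega

open Finset in
lemma Hgraph_isIndFree_P2UP4 (n : ℕ) : IsIndFree P2UP4 (Hgraph n) := by
  refine ⟨fun f => ?_⟩
  have hcard : 4 ≤ #{i | (f i).isRight} := by
    refine four_le_card_of_compl_clique _ fun i j hij hadj => ?_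
    rw [← f.map_adj_iff] at hadj
    have hne : f i ≠ f j := f.injective.ne hij
    simp only [mem_filter, mem_univ, true_and]
    generalize f i = x at *
    generalize f j = y at *
    rcases x with x | x <;> rcases y with y | y <;> simp_all [Hgraph_adj_inl_inl]
  have hle : #{i | (f i).isRight} ≤
      #((univ : Finset (Fin 3)).map .inr : Finset (Fin n ⊕ Fin 3)) := by
    refine card_le_card_of_injOn f (fun i hi => ?_) f.injective.injOn
    obtain ⟨c, hc⟩ := Sum.isRight_iff.mp (mem_filter.mp hi).2
    simp [hc]
  rw [card_map, card_univ, Fintype.card_fin] at hle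
  omega

lemma Hgraph_isIndFree_diamond (n : ℕ) : IsIndFree diamond (Hgraph n) := by
  refine ⟨fun f => ?_⟩
  have hadj {i j : Fin 4} (h : diamond.Adj i j) : (Hgraph n).Adj (f i) (f j) :=
    f.map_adj_iff.mpr h
  have h02 := hadj (i := 0) (j := 2) (by simp [diamond])
  have h03 := hadj (i := 0) (j := 3) (by simp [diamond])
  have h12 := hadj (i := 1) (j := 2) (by simp [diamond])
  have h13 := hadj (i := 1) (j := 3) (by simp [diamond])
  have h23 := hadj (i := 2) (j := 3) (by simp [diamond])
  have h01 : ¬ (Hgraph n).Adj (f 0) (f 1) := by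
    rw [f.map_adj_iff]
    simp [diamond]
  obtain ⟨a, ha⟩ := Sum.isLeft_iff.mp (Hgraph_isLeft_of_triangle h02 h03 h23)
  obtain ⟨b, hb⟩ := Sum.isLeft_iff.mp (Hgraph_isLeft_of_triangle h12 h13 h23)
  rw [ha, hb, Hgraph_adj_inl_inl, not_not] at h01
  exact absurd (f.injective (ha.trans (h01 ▸ hb.symm))) (by decide)

lemma Hgraph_colorable {n : ℕ} (hn : 3 ≤ n) : (Hgraph n).Colorable n := by
  refine ⟨Coloring.mk
    (Sum.elim id ![⟨1, by omega⟩, ⟨2, by omega⟩, ⟨0, by omega⟩]) fun {x y} h => ?_⟩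
  rcases x with x | x <;> rcases y with y | y <;>
    simp only [Hgraph_adj_inl_inl, Hgraph_adj_inl_inr, Hgraph_adj_inr_inl,
      Hgraph_adj_inr_inr] at h
  · exact h
  · fin_cases y <;> simp_all [Fin.ext_iff]
  · fin_cases x <;> simp_all [Fin.ext_iff, eq_comm]
  · fin_cases x <;> fin_cases y <;> simp_all

lemma le_cliqueNum_Hgraph (n : ℕ) : n ≤ (Hgraph n).cliqueNum := by
  have hc : (Hgraph n).IsClique
      ((Finset.univ : Finset (Fin n)).map .inl : Finset (Fin n ⊕ Fin 3)) := by
    intro x hx y hy hxy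
    simp only [Finset.coe_map, Finset.coe_univ, Set.image_univ, Set.mem_range] at hx hy
    obtain ⟨i, rfl⟩ := hx
    obtain ⟨j, rfl⟩ := hy
    exact (Hgraph_adj_inl_inl i j).mpr fun h => hxy (h ▸ rfl)
  simpa using hc.card_le_cliqueNum

/-- `Hgraph n` has an induced 5-cycle through the three vertices outside the complete part. -/
lemma nonempty_cycleGraph_five_embedding_Hgraph {n : ℕ} (hn : 2 ≤ n) :
    Nonempty (cycleGraph 5 ↪g Hgraph n) := by
  let v : Fin 5 → Fin n ⊕ Fin 3 :=
    ![.inl ⟨0, by omega⟩, .inr 0, .inr 1, .inr 2, .inl ⟨1, by omega⟩]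
  have hinj : Function.Injective v := by
    intro i j h
    fin_cases i <;> fin_cases j <;> simp_all [v]
  have hadj (i j : Fin 5) : (Hgraph n).Adj (v i) (v j) ↔ (cycleGraph 5).Adj i j := by
    rw [cycleGraph_adj]
    fin_cases i <;> fin_cases j <;>
      simp [v, Hgraph_adj_inl_inl, Hgraph_adj_inl_inr, Hgraph_adj_inr_inl,
        Hgraph_adj_inr_inr] <;>
      decide
  exact ⟨⟨⟨v, hinj⟩, hadj _ _⟩⟩

lemma cycleGraph_five_cliqueFree : (cycleGraph 5).CliqueFree 3 := by
  intro s hs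
  obtain ⟨a, b, c, hab, hac, hbc, -⟩ := is3Clique_iff.mp hs
  revert a b c
  simp only [cycleGraph_adj]
  decide

lemma not_isPerfect_of_cycleGraph_five {V : Type*} {G : SimpleGraph V}
    (f : cycleGraph 5 ↪g G) : ¬ IsPerfect G := by
  intro h
  let e := f.isoInduceRange
  have hfree : (G.induce (Set.range f)).CliqueFree 3 :=
    cycleGraph_five_cliqueFree.comap e.symm.toCopy.isContained
  have hchi : (G.induce (Set.range f)).chromaticNumber = 3 := by
    rw [← chromaticNumber_cycleGraph_of_odd 5 (by norm_num) (by decide)]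
    exact le_antisymm (chromaticNumber_mono_of_hom e.symm.toHom)
      (chromaticNumber_mono_of_hom e.toHom)
  have hnum : (G.induce (Set.range f)).cliqueNum = 3 := by
    exact_mod_cast (h (Set.range f)).symm.trans hchi
  obtain ⟨s, hs⟩ := (G.induce (Set.range f)).exists_isNClique_cliqueNum
  exact hfree s (hnum ▸ hs)

theorem Hgraph_properties (n : ℕ) (hn : 4 ≤ n) :
    IsIndFree P2UP4 (Hgraph n) ∧ IsIndFree diamond (Hgraph n) ∧
    (Hgraph n).chromaticNumber = (n : ℕ∞) ∧ (Hgraph n).cliqueNum = n ∧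
    Nonempty (SimpleGraph.cycleGraph 5 ↪g Hgraph n) ∧ ¬ IsPerfect (Hgraph n) := by
  have hχ : (Hgraph n).chromaticNumber ≤ n :=
    (Hgraph_colorable (by omega)).chromaticNumber_le
  have hω : ((Hgraph n).cliqueNum : ℕ∞) ≤ (Hgraph n).chromaticNumber :=
    cliqueNum_le_chromaticNumber
  have hn_le : (n : ℕ∞) ≤ (Hgraph n).cliqueNum := by exact_mod_cast le_cliqueNum_Hgraph n
  obtain ⟨f⟩ := nonempty_cycleGraph_five_embedding_Hgraph (show 2 ≤ n by omega)
  refine ⟨Hgraph_isIndFree_P2UP4 n, Hgraph_isIndFree_diamond n,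
    le_antisymm hχ (hn_le.trans hω), ?_, ⟨f⟩, not_isPerfect_of_cycleGraph_five f⟩
  exact_mod_cast le_antisymm (hω.trans hχ) hn_le
end
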